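/- arXiv:1201.4062 — 2 statements merged into one kernel-verified Lean document; each statement's English description precedes it below -/
import Mathlib

section
/- Let n ∈ ℕ and let φ : ℝ^n × [0,∞) → [0,∞) be such that φ(x,·) is an Orlicz function for every x and φ(·,t) is measurable for every t, φ ∈ 𝔸_q(ℝ^n) for some q ∈ [1,∞), and φ is of uniformly lower type p⁻ and of uniformly upper type p⁺ with q(φ) < p⁻ ≤ p⁺ < ∞. Then the Hardy–Littlewood maximal function M is bounded on L^φ(ℝ^n) and, moreover, there exists a constant C > 0 such that for all f ∈ L^φ(ℝ^n), ∫_{ℝ^n} φ(x, Mf(x)) dx ≤ C ∫_{ℝ^n} φ(x, |f(x)|) dx. -/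
open MeasureTheory Metric Filter
open scoped ENNReal NNReal Topology FourierTransform Classical

noncomputable section

abbrev Rn (n : ℕ) := EuclideanSpace ℝ (Fin n)

/-- An Orlicz function on `[0,∞)`. -/
structure IsOrliczFn (Φ : ℝ → ℝ) : Prop where
  mono : ∀ ⦃s t : ℝ⦄, 0 ≤ s → s ≤ t → Φ s ≤ Φ t
  map_zero : Φ 0 = 0
  pos : ∀ t : ℝ, 0 < t → 0 < Φ t
  tendsto_atTop : Filter.Tendsto Φ Filter.atTop Filter.atTop

/-- `φ` is of uniformly lower type `p`. -/
def UniformLowerType {n : ℕ} (φ : Rn n → ℝ → ℝ) (p : ℝ) : Prop :=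
  ∃ C : ℝ, 0 < C ∧ ∀ (x : Rn n) (t s : ℝ), 0 ≤ t → 0 ≤ s → s ≤ 1 →
    φ x (s * t) ≤ C * s ^ p * φ x t

/-- `φ` is of uniformly upper type `p`. -/
def UniformUpperType {n : ℕ} (φ : Rn n → ℝ → ℝ) (p : ℝ) : Prop :=
  ∃ C : ℝ, 0 < C ∧ ∀ (x : Rn n) (t s : ℝ), 0 ≤ t → 1 ≤ s →
    φ x (s * t) ≤ C * s ^ p * φ x t

/-- The uniform Muckenhoupt condition `φ ∈ 𝔸_q(ℝⁿ)`, for `q ∈ [1,∞)`. -/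
def MemUniformA {n : ℕ} (φ : Rn n → ℝ → ℝ) (q : ℝ) : Prop :=
  (q = 1 ∧ ∃ C : ℝ≥0∞, C ≠ ∞ ∧ ∀ t : ℝ, 0 ≤ t → ∀ (z : Rn n) (ρ : ℝ), 0 < ρ →
      (∫⁻ x in ball z ρ, ENNReal.ofReal (φ x t)) *
        essSup (fun y => (ENNReal.ofReal (φ y t))⁻¹) (volume.restrict (ball z ρ)) ≤
      C * volume (ball z ρ)) ∨
  (1 < q ∧ ∃ C : ℝ≥0∞, C ≠ ∞ ∧ ∀ t : ℝ, 0 ≤ t → ∀ (z : Rn n) (ρ : ℝ), 0 < ρ →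
      (∫⁻ x in ball z ρ, ENNReal.ofReal (φ x t)) *
        (∫⁻ y in ball z ρ, (ENNReal.ofReal (φ y t)) ^ (-(1 / (q - 1)))) ^ (q - 1) ≤
      C * volume (ball z ρ) ^ q)

/-- The critical index `q(φ)`. -/
def qIndex {n : ℕ} (φ : Rn n → ℝ → ℝ) : ℝ := sInf {q : ℝ | MemUniformA φ q}

/-- The index `i(φ)`. -/
def iIndex {n : ℕ} (φ : Rn n → ℝ → ℝ) : ℝ := sSup {p : ℝ | 0 < p ∧ UniformLowerType φ p}

/-- The index `m(φ) = ⌊n (q(φ)/i(φ) - 1)⌋`. -/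
def mIndex {n : ℕ} (φ : Rn n → ℝ → ℝ) : ℕ := (⌊(n : ℝ) * (qIndex φ / iIndex φ - 1)⌋).toNat

/-- A growth function. -/
structure IsGrowthFn {n : ℕ} (φ : Rn n → ℝ → ℝ) : Prop where
  orlicz : ∀ x, IsOrliczFn (φ x)
  meas : ∀ t : ℝ, Measurable fun x => φ x t
  memA : ∃ q : ℝ, MemUniformA φ q
  lowerType : ∃ p : ℝ, 0 < p ∧ p ≤ 1 ∧ UniformLowerType φ p
  upperType : UniformUpperType φ 1

/-- `∫_{ℝⁿ} φ(x,|f(x)|) dx`. -/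
def phiIntegral {n : ℕ} (φ : Rn n → ℝ → ℝ) (f : Rn n → ℝ) : ℝ≥0∞ :=
  ∫⁻ x, ENNReal.ofReal (φ x |f x|)

/-- Membership in the Musielak–Orlicz space `L^φ(ℝⁿ)`. -/
def MemLphi {n : ℕ} (φ : Rn n → ℝ → ℝ) (f : Rn n → ℝ) : Prop :=
  AEMeasurable f ∧ phiIntegral φ f < ∞

/-- The Luxembourg quasi-norm on `L^φ(ℝⁿ)`. -/
def LuxNorm {n : ℕ} (φ : Rn n → ℝ → ℝ) (f : Rn n → ℝ) : ℝ :=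
  sInf {c : ℝ | 0 < c ∧ (∫⁻ x, ENNReal.ofReal (φ x (|f x| / c))) ≤ 1}

/-- Weighted `L^p` membership: `f ∈ L^p_w(ℝⁿ)`. -/
def MemLpw {n : ℕ} (w : Rn n → ℝ) (p : ℝ) (f : Rn n → ℝ) : Prop :=
  AEMeasurable f ∧ (∫⁻ x, ENNReal.ofReal (|f x| ^ p * w x)) < ∞

/-- The `ℓ^r` norm (in `ℝ≥0∞`) of a family of reals, `r ∈ [1,∞]`;
sums are replaced by suprema when `r = ∞`. -/
def lrNormE (r : ℝ≥0∞) {ι : Type*} (a : ι → ℝ) : ℝ≥0∞ :=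
  if r = ∞ then ⨆ j, (‖a j‖₊ : ℝ≥0∞)
  else (∑' j, (‖a j‖₊ : ℝ≥0∞) ^ r.toReal) ^ (1 / r.toReal)

/-- The Hardy–Littlewood maximal function (real-valued). -/
def hlMax {n : ℕ} (f : Rn n → ℝ) (x : Rn n) : ℝ :=
  sSup {a : ℝ | ∃ (z : Rn n) (ρ : ℝ), 0 < ρ ∧ x ∈ ball z ρ ∧
    a = ((∫⁻ y in ball z ρ, ENNReal.ofReal |f y|) / volume (ball z ρ)).toReal}

/-- The Hardy–Littlewood maximal function (with values in `ℝ≥0∞`). -/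
def hlMaxE {n : ℕ} (f : Rn n → ℝ) (x : Rn n) : ℝ≥0∞ :=
  ⨆ (z : Rn n) (ρ : ℝ) (_ : 0 < ρ) (_ : x ∈ ball z ρ),
    (∫⁻ y in ball z ρ, ENNReal.ofReal |f y|) / volume (ball z ρ)

/-- The operator `K_B g(x) = ∫ |g(y)| 2^{-B|x-y|} dy`. -/
def kernelKE {n : ℕ} (B : ℝ) (g : Rn n → ℝ) (x : Rn n) : ℝ≥0∞ :=
  ∫⁻ y, ENNReal.ofReal (|g y| * (2 : ℝ) ^ (-(B * ‖x - y‖)))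

/-- Tempered distributions on `ℝⁿ`. -/
abbrev TemperedDist (n : ℕ) := SchwartzMap (Rn n) ℝ →L[ℝ] ℝ

/-- The Schwartz map whose underlying function is `g` (junk value if there is none). -/
def toSchwartz {n : ℕ} (g : Rn n → ℝ) : SchwartzMap (Rn n) ℝ :=
  if h : ∃ ψ : SchwartzMap (Rn n) ℝ, ⇑ψ = g then h.choose else 0

/-- The pairing of a tempered distribution with a (Schwartz) function. -/
def distPair {n : ℕ} (f : TemperedDist n) (g : Rn n → ℝ) : ℝ := f (toSchwartz g)

/-- The convolution `f * g (y) = f(z ↦ g(y - z))` of a tempered distribution `f`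
with a (Schwartz) function `g`. -/
def convF {n : ℕ} (f : TemperedDist n) (g : Rn n → ℝ) (y : Rn n) : ℝ :=
  distPair f fun z => g (y - z)

/-- The dilation `g_t(x) = t^{-n} g(x/t)`. -/
def dilat {n : ℕ} (g : Rn n → ℝ) (t : ℝ) : Rn n → ℝ :=
  fun x => (t ^ n)⁻¹ * g (t⁻¹ • x)

/-- The dyadic dilation `g_j(x) = 2^{jn} g(2^j x)`, `j ∈ ℤ`. -/
def dyadic {n : ℕ} (g : Rn n → ℝ) (j : ℤ) : Rn n → ℝ :=
  fun x => (2 : ℝ) ^ (j * (n : ℤ)) * g ((2 : ℝ) ^ j • x)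

/-- The weight `m_{j,A,B}(y) = (1 + 2^j |y|)^A 2^{B|y|}`. -/
def mJAB {n : ℕ} (j : ℤ) (A B : ℝ) (y : Rn n) : ℝ :=
  (1 + (2 : ℝ) ^ j * ‖y‖) ^ A * (2 : ℝ) ^ (B * ‖y‖)

/-- The vertical maximal function `ψ₀⁺(f)`. -/
def vertMax {n : ℕ} (ψ₀ : Rn n → ℝ) (f : TemperedDist n) (x : Rn n) : ℝ :=
  ⨆ j : ℤ, |convF f (dyadic ψ₀ j) x|

/-- The tangential Peetre-type maximal function `ψ₀,A,B^{**}(f)`. -/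
def peetreMaxStar {n : ℕ} (ψ₀ : Rn n → ℝ) (A B : ℝ) (f : TemperedDist n) (x : Rn n) : ℝ :=
  ⨆ (j : ℤ) (y : Rn n), |convF f (dyadic ψ₀ j) (x - y)| / mJAB j A B y

/-- The single-scale Peetre-type maximal function `(ψ₀)*_{j,A,B}(f)` (in `ℝ≥0∞`). -/
def peetreJE {n : ℕ} (ψ₀ : Rn n → ℝ) (j : ℤ) (A B : ℝ) (f : TemperedDist n) (x : Rn n) : ℝ≥0∞ :=
  ⨆ y : Rn n, ENNReal.ofReal (|convF f (dyadic ψ₀ j) (x - y)| / mJAB j A B y)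

/-- The nontangential maximal function `(ψ₀)_∇^*(f)`. -/
def nontanMax {n : ℕ} (ψ₀ : Rn n → ℝ) (f : TemperedDist n) (x : Rn n) : ℝ :=
  ⨆ (y : Rn n) (t : ℝ) (_ : 0 < t) (_ : dist x y < t), |convF f (dilat ψ₀ t) y|

/-- Membership in the family `𝒮_m(ℝⁿ)`. -/
def inSm {n : ℕ} (m : ℕ) (ψ : SchwartzMap (Rn n) ℝ) : Prop :=
  ∀ (x : Rn n) (k : ℕ), k ≤ m + 1 → ∀ e : Fin k → Fin n,
    (1 + ‖x‖) ^ ((m + 2) * (n + 1)) *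
      |iteratedFDeriv ℝ k (⇑ψ) x fun i => EuclideanSpace.single (e i) (1 : ℝ)| ≤ 1

/-- The grand maximal function `f*_m`. -/
def grandMax {n : ℕ} (m : ℕ) (f : TemperedDist n) (x : Rn n) : ℝ :=
  ⨆ (ψ : {ψ : SchwartzMap (Rn n) ℝ // inSm m ψ}) (y : Rn n) (t : ℝ) (_ : 0 < t)
    (_ : dist y x < t), |convF f (dilat (⇑ψ.1) t) y|

/-- Membership in the Musielak–Orlicz Hardy space `H^φ(ℝⁿ)`. -/
def MemHphi {n : ℕ} (φ : Rn n → ℝ → ℝ) (f : TemperedDist n) : Prop :=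
  MemLphi φ (grandMax (mIndex φ) f)

/-- The quasi-norm on `H^φ(ℝⁿ)`. -/
def HphiNorm {n : ℕ} (φ : Rn n → ℝ → ℝ) (f : TemperedDist n) : ℝ :=
  LuxNorm φ (grandMax (mIndex φ) f)

/-- The Littlewood–Paley `g`-function. -/
def gFun {n : ℕ} (g : Rn n → ℝ) (f : TemperedDist n) (x : Rn n) : ℝ :=
  ((∫⁻ t in Set.Ioi (0 : ℝ),
      ENNReal.ofReal (|convF f (dilat g t) x| ^ 2 / t)).toReal) ^ (1 / 2 : ℝ)

/-- The Lusin area function `S(f)`. -/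
def sFun {n : ℕ} (g : Rn n → ℝ) (f : TemperedDist n) (x : Rn n) : ℝ :=
  ((∫⁻ t in Set.Ioi (0 : ℝ),
      (∫⁻ y in ball x t, ENNReal.ofReal (|convF f (dilat g t) y| ^ 2)) /
        ENNReal.ofReal (t ^ (n + 1))).toReal) ^ (1 / 2 : ℝ)

/-- The dilated Lusin area function `S_α(f)`. -/
def sAlphaFun {n : ℕ} (g : Rn n → ℝ) (α : ℝ) (f : TemperedDist n) (x : Rn n) : ℝ :=
  ((∫⁻ t in Set.Ioi (0 : ℝ),
      (∫⁻ y in ball x (α * t), ENNReal.ofReal (|convF f (dilat g t) y| ^ 2)) /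
        ENNReal.ofReal ((α * t) ^ n * t)).toReal) ^ (1 / 2 : ℝ)

/-- The Littlewood–Paley `g_λ^*`-function. -/
def gLamFun {n : ℕ} (g : Rn n → ℝ) (lam : ℝ) (f : TemperedDist n) (x : Rn n) : ℝ :=
  ((∫⁻ t in Set.Ioi (0 : ℝ),
      (∫⁻ y, ENNReal.ofReal
          ((t / (t + dist x y)) ^ (lam * (n : ℝ)) * |convF f (dilat g t) y| ^ 2)) /
        ENNReal.ofReal (t ^ (n + 1))).toReal) ^ (1 / 2 : ℝ)

/-- `g` is a radial function. -/
def RadialFn {n : ℕ} (g : Rn n → ℝ) : Prop := ∀ x y : Rn n, ‖x‖ = ‖y‖ → g x = g y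

/-- `g` has vanishing moments up to order `m`. -/
def VanishingMoments {n : ℕ} (g : Rn n → ℝ) (m : ℕ) : Prop :=
  ∀ γ : Fin n → ℕ, (∑ i, γ i) ≤ m → (∫ x : Rn n, g x * ∏ i, (x i) ^ γ i) = 0

/-- The Calderón reproducing normalization `∫_0^∞ |ĝ(tξ)|² dt/t = 1` for `ξ ≠ 0`. -/
def CalderonNormalized {n : ℕ} (g : Rn n → ℝ) : Prop :=
  ∀ ξ : Rn n, ξ ≠ 0 →
    (∫ t in Set.Ioi (0 : ℝ), ‖𝓕 (fun x : Rn n => (g x : ℂ)) (t • ξ)‖ ^ 2 / t) = 1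

/-- `f ∈ 𝒮'(ℝⁿ)` vanishes weakly at infinity. -/
def VanishWeakInfty {n : ℕ} (f : TemperedDist n) : Prop :=
  ∀ θ ψ : SchwartzMap (Rn n) ℝ,
    Filter.Tendsto (fun t : ℝ => ∫ x, convF f (dilat (⇑θ) t) x * ψ x)
      Filter.atTop (𝓝 0)

/-- `φ(·,t)` is uniformly locally integrable. -/
def UnifLocInt {n : ℕ} (φ : Rn n → ℝ → ℝ) : Prop :=
  ∀ K : Set (Rn n), IsCompact K →
    (∫⁻ x in K, ⨆ (t : ℝ) (_ : 0 < t),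
      ENNReal.ofReal (φ x t) / ∫⁻ y in K, ENNReal.ofReal (φ y t)) < ∞

/-- `φ̃(x,t) = ∫_0^t φ(x,s)/s ds`. -/
def phiTilde {n : ℕ} (φ : Rn n → ℝ → ℝ) (x : Rn n) (t : ℝ) : ℝ :=
  ∫ s in (0 : ℝ)..t, φ x s / s

lemma strongA {n : ℕ} {φ : Rn n → ℝ → ℝ} {q : ℝ} (hpos : ∀ x t, 0 < t → 0 < φ x t)
    (hmeas : ∀ t : ℝ, Measurable fun x => φ x t) (h : MemUniformA φ q) :
    1 ≤ q ∧ ∃ C : ℝ≥0∞, C ≠ ∞ ∧ ∀ t : ℝ, 0 < t → ∀ (z : Rn n) (ρ : ℝ), 0 < ρ →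
      ∀ g : Rn n → ℝ≥0∞, Measurable g →
      (∫⁻ x in ball z ρ, g x) ^ q * ∫⁻ x in ball z ρ, ENNReal.ofReal (φ x t) ≤
        C * volume (ball z ρ) ^ q * ∫⁻ x in ball z ρ, g x ^ q * ENNReal.ofReal (φ x t) := by
  rcases h with ⟨rfl, C, hC, h⟩ | ⟨hq, C, hC, h⟩
  · refine ⟨le_rfl, C, hC, fun t ht z ρ hρ g hg => ?_⟩
    have h0 := h t ht.le z ρ hρ
    set S := essSup (fun y => (ENNReal.ofReal (φ y t))⁻¹) (volume.restrict (ball z ρ)) with hS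
    have h1 : ∫⁻ x in ball z ρ, g x ≤ S * ∫⁻ x in ball z ρ, g x * ENNReal.ofReal (φ x t) := by
      rw [← lintegral_const_mul S (f := fun x => g x * ENNReal.ofReal (φ x t))
        (hg.mul (hmeas t).ennreal_ofReal)]
      apply lintegral_mono_ae
      filter_upwards [ENNReal.ae_le_essSup (μ := volume.restrict (ball z ρ))
        (fun y => (ENNReal.ofReal (φ y t))⁻¹)] with x hx
      have hx0 : ENNReal.ofReal (φ x t) ≠ 0 := by simpa using hpos x t ht
      calc g x = (ENNReal.ofReal (φ x t))⁻¹ * (g x * ENNReal.ofReal (φ x t)) := by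
            rw [mul_comm (g x), ← mul_assoc, ENNReal.inv_mul_cancel hx0 ENNReal.ofReal_ne_top,
              one_mul]
        _ ≤ _ := by gcongr
    simp only [ENNReal.rpow_one]
    calc _ ≤ (S * ∫⁻ x in ball z ρ, g x * ENNReal.ofReal (φ x t)) *
          ∫⁻ x in ball z ρ, ENNReal.ofReal (φ x t) := by gcongr
      _ = ((∫⁻ x in ball z ρ, ENNReal.ofReal (φ x t)) * S) *
          ∫⁻ x in ball z ρ, g x * ENNReal.ofReal (φ x t) := by ring
      _ ≤ _ := by gcongr
  · refine ⟨hq.le, C, hC, fun t ht z ρ hρ g hg => ?_⟩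
    have h0 := h t ht.le z ρ hρ
    have hq0 : 0 < q := by linarith
    have hq1 : 0 < q - 1 := by linarith
    have hc : q.HolderConjugate (q / (q - 1)) := Real.HolderConjugate.conjExponent hq
    have hw := (hmeas t).ennreal_ofReal
    have h1 := ENNReal.lintegral_mul_le_Lp_mul_Lq (volume.restrict (ball z ρ)) hc
      (f := fun x => g x * ENNReal.ofReal (φ x t) ^ (1 / q))
      (g := fun x => ENNReal.ofReal (φ x t) ^ (-(1 / q)))
      (hg.mul (hw.pow_const _)).aemeasurable (hw.pow_const _).aemeasurable
    have e1 : ∀ x, ((fun x => g x * ENNReal.ofReal (φ x t) ^ (1 / q)) *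
        (fun x => ENNReal.ofReal (φ x t) ^ (-(1 / q)))) x = g x := by
      intro x
      have hx0 : ENNReal.ofReal (φ x t) ≠ 0 := by simpa using hpos x t ht
      simp only [Pi.mul_apply]
      rw [mul_assoc, ← ENNReal.rpow_add _ _ hx0 ENNReal.ofReal_ne_top]
      simp
    have e2 : ∀ x, (g x * ENNReal.ofReal (φ x t) ^ (1 / q)) ^ q =
        g x ^ q * ENNReal.ofReal (φ x t) := by
      intro x
      rw [ENNReal.mul_rpow_of_nonneg _ _ hq0.le, ← ENNReal.rpow_mul, one_div,
        inv_mul_cancel₀ hq0.ne', ENNReal.rpow_one]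
    have e3 : ∀ x, (ENNReal.ofReal (φ x t) ^ (-(1 / q))) ^ (q / (q - 1)) =
        ENNReal.ofReal (φ x t) ^ (-(1 / (q - 1))) := by
      intro x
      rw [← ENNReal.rpow_mul]
      congr 1
      field_simp
    simp only [e1, e2, e3] at h1
    have h2 := ENNReal.rpow_le_rpow h1 hq0.le
    rw [ENNReal.mul_rpow_of_nonneg _ _ hq0.le, ← ENNReal.rpow_mul, ← ENNReal.rpow_mul, one_div,
        inv_mul_cancel₀ hq0.ne', ENNReal.rpow_one,
        show 1 / (q / (q - 1)) * q = q - 1 by field_simp] at h2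
    calc _ ≤ ((∫⁻ x in ball z ρ, g x ^ q * ENNReal.ofReal (φ x t)) *
          (∫⁻ x in ball z ρ, ENNReal.ofReal (φ x t) ^ (-(1 / (q - 1)))) ^ (q - 1)) *
          ∫⁻ x in ball z ρ, ENNReal.ofReal (φ x t) := by gcongr
      _ = ((∫⁻ x in ball z ρ, ENNReal.ofReal (φ x t)) *
          (∫⁻ x in ball z ρ, ENNReal.ofReal (φ x t) ^ (-(1 / (q - 1)))) ^ (q - 1)) *
          ∫⁻ x in ball z ρ, g x ^ q * ENNReal.ofReal (φ x t) := by ring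
      _ ≤ _ := by gcongr

/-- The superlevel set of the maximal function. -/
def levelSet {n : ℕ} (g : Rn n → ℝ≥0∞) (lam : ℝ≥0∞) : Set (Rn n) :=
  ⋃ b : {b : Rn n × ℝ // 0 < b.2 ∧ lam * volume (ball b.1 b.2) < ∫⁻ y in ball b.1 b.2, g y},
    ball b.1.1 b.1.2

lemma isOpen_levelSet {n : ℕ} (g : Rn n → ℝ≥0∞) (lam : ℝ≥0∞) : IsOpen (levelSet g lam) :=
  isOpen_iUnion fun _ => isOpen_ball

lemma weakType {n : ℕ} (w : Rn n → ℝ≥0∞) (hw : Measurable w) {q : ℝ} (hq : 1 ≤ q) (C : ℝ≥0∞)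
    (H : ∀ (z : Rn n) (ρ : ℝ), 0 < ρ → ∀ g : Rn n → ℝ≥0∞, Measurable g →
      (∫⁻ x in ball z ρ, g x) ^ q * ∫⁻ x in ball z ρ, w x ≤
        C * volume (ball z ρ) ^ q * ∫⁻ x in ball z ρ, g x ^ q * w x)
    (g : Rn n → ℝ≥0∞) (hg : Measurable g) (lam : ℝ≥0∞) :
    lam ^ q * ∫⁻ x in levelSet g lam, w x ≤
      C * ENNReal.ofReal (6 ^ n) ^ q * C * ∫⁻ x, g x ^ q * w x := by
  have hq0 : 0 < q := by linarith
  set μ := (volume : Measure (Rn n)).withDensity w with hμ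
  have hμa : ∀ s, μ s = ∫⁻ x in s, w x := fun s => withDensity_apply' _ s
  have hvol : ∀ (z : Rn n) (ρ : ℝ), 0 < ρ → volume (ball z ρ) ^ q ≠ 0 ∧
      volume (ball z ρ) ^ q ≠ ∞ := by
    intro z ρ hρ
    have h1 : volume (ball z ρ) ≠ 0 := (measure_ball_pos volume z hρ).ne'
    have h2 : volume (ball z ρ) ≠ ∞ := measure_ball_lt_top.ne
    exact ⟨(ENNReal.rpow_pos (pos_iff_ne_zero.2 h1) h2).ne', ENNReal.rpow_ne_top_of_nonneg hq0.le h2⟩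
  -- doubling
  have hdoub : ∀ (z : Rn n) (ρ : ℝ), 0 < ρ →
      μ (ball z (6 * ρ)) ≤ C * ENNReal.ofReal (6 ^ n) ^ q * μ (ball z ρ) := by
    intro z ρ hρ
    have hsub : ball z ρ ⊆ ball z (6 * ρ) := ball_subset_ball (by linarith)
    have h1 := H z (6 * ρ) (by linarith) ((ball z ρ).indicator 1)
      (measurable_one.indicator measurableSet_ball)
    have e1 : ∫⁻ x in ball z (6 * ρ), (ball z ρ).indicator 1 x = volume (ball z ρ) := by
      rw [lintegral_indicator_one measurableSet_ball, Measure.restrict_apply measurableSet_ball,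
        Set.inter_eq_left.2 hsub]
    have e2 : ∫⁻ x in ball z (6 * ρ), (ball z ρ).indicator 1 x ^ q * w x = μ (ball z ρ) := by
      have : ∀ x, (ball z ρ).indicator (1 : Rn n → ℝ≥0∞) x ^ q * w x =
          (ball z ρ).indicator w x := by
        intro x
        by_cases hx : x ∈ ball z ρ
        · simp only [Set.indicator_of_mem hx]; simp
        · simp only [Set.indicator_of_notMem hx]; simp [hq0]
      simp only [this]
      rw [setLIntegral_indicator measurableSet_ball, Set.inter_eq_left.2 hsub, hμa]
    have e3 : volume (ball z (6 * ρ)) = ENNReal.ofReal (6 ^ n) * volume (ball z ρ) := by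
      rw [Measure.addHaar_ball_mul_of_pos _ _ (by norm_num), Measure.addHaar_ball_center volume z]
      simp
    rw [e1, e2, ← hμa, e3, ENNReal.mul_rpow_of_nonneg _ _ hq0.le] at h1
    obtain ⟨v0, v1⟩ := hvol z ρ hρ
    rw [← ENNReal.mul_le_mul_iff_right v0 v1]
    calc _ ≤ _ := h1
      _ = _ := by ring
  have hball : ∀ (z : Rn n) (ρ : ℝ), 0 < ρ → lam * volume (ball z ρ) < ∫⁻ y in ball z ρ, g y →
      lam ^ q * μ (ball z ρ) ≤ C * ∫⁻ x in ball z ρ, g x ^ q * w x := by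
    intro z ρ hρ hlt
    have h1 := H z ρ hρ g hg
    obtain ⟨v0, v1⟩ := hvol z ρ hρ
    rw [← ENNReal.mul_le_mul_iff_right v0 v1]
    calc _ = (lam * volume (ball z ρ)) ^ q * μ (ball z ρ) := by
          rw [ENNReal.mul_rpow_of_nonneg _ _ hq0.le]; ring
      _ ≤ (∫⁻ y in ball z ρ, g y) ^ q * μ (ball z ρ) := by gcongr
      _ ≤ C * volume (ball z ρ) ^ q * ∫⁻ x in ball z ρ, g x ^ q * w x := by
          rw [hμa]; exact h1
      _ = _ := by ring
  rw [← hμa]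
  obtain ⟨T, hT, hTU⟩ := TopologicalSpace.isOpen_iUnion_countable
    (fun b : {b : Rn n × ℝ // 0 < b.2 ∧ lam * volume (ball b.1 b.2) < ∫⁻ y in ball b.1 b.2, g y} =>
    ball b.1.1 b.1.2) (fun _ => isOpen_ball)
  have hfin : ∀ F : Finset {b : Rn n × ℝ // 0 < b.2 ∧
      lam * volume (ball b.1 b.2) < ∫⁻ y in ball b.1 b.2, g y},
      lam ^ q * μ (⋃ b ∈ F, ball b.1.1 b.1.2) ≤
      C * ENNReal.ofReal (6 ^ n) ^ q * C * ∫⁻ x, g x ^ q * w x := by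
    intro F
    obtain ⟨R, hR⟩ : ∃ R : ℝ, ∀ b ∈ F, b.1.2 ≤ R := by
      obtain ⟨R, hR⟩ := (F.image fun b => b.1.2).bddAbove
      exact ⟨R, fun b hb => hR (Finset.mem_coe.2 (Finset.mem_image_of_mem (fun b => b.1.2) hb))⟩
    obtain ⟨u, huF, hud, hcov⟩ := Vitali.exists_disjoint_subfamily_covering_enlargement_closedBall
      (↑F : Set {b : Rn n × ℝ // 0 < b.2 ∧
        lam * volume (ball b.1 b.2) < ∫⁻ y in ball b.1 b.2, g y})
      (fun b => b.1.1) (fun b => b.1.2) R hR 5 (by norm_num)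
    have hufin : u.Finite := F.finite_toSet.subset huF
    have hsub : (⋃ b ∈ F, ball b.1.1 b.1.2) ⊆ ⋃ b ∈ u, ball b.1.1 (6 * b.1.2) := by
      intro x hx
      simp only [Set.mem_iUnion] at hx ⊢
      obtain ⟨b, hb, hx⟩ := hx
      obtain ⟨c, hc, hbc⟩ := hcov b hb
      refine ⟨c, hc, ?_⟩
      exact closedBall_subset_ball (by linarith [c.2.1]) (hbc (ball_subset_closedBall hx))
    calc lam ^ q * μ (⋃ b ∈ F, ball b.1.1 b.1.2)
        ≤ lam ^ q * μ (⋃ b ∈ u, ball b.1.1 (6 * b.1.2)) := by gcongr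
      _ ≤ lam ^ q * ∑' b : u, μ (ball b.1.1.1 (6 * b.1.1.2)) := by
          gcongr; exact measure_biUnion_le _ hufin.countable _
      _ = ∑' b : u, lam ^ q * μ (ball b.1.1.1 (6 * b.1.1.2)) := ENNReal.tsum_mul_left.symm
      _ ≤ ∑' b : u, C * ENNReal.ofReal (6 ^ n) ^ q * C *
            ∫⁻ x in ball b.1.1.1 b.1.1.2, g x ^ q * w x := by
          refine ENNReal.tsum_le_tsum fun b => ?_
          calc _ ≤ lam ^ q * (C * ENNReal.ofReal (6 ^ n) ^ q * μ (ball b.1.1.1 b.1.1.2)) := by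
                gcongr; exact hdoub _ _ b.1.2.1
            _ = C * ENNReal.ofReal (6 ^ n) ^ q * (lam ^ q * μ (ball b.1.1.1 b.1.1.2)) := by ring
            _ ≤ C * ENNReal.ofReal (6 ^ n) ^ q *
                (C * ∫⁻ x in ball b.1.1.1 b.1.1.2, g x ^ q * w x) := by
                exact mul_le_mul_right (hball _ _ b.1.2.1 b.1.2.2) _
            _ = _ := by ring
      _ = C * ENNReal.ofReal (6 ^ n) ^ q * C * ∑' b : u,
            ∫⁻ x in ball b.1.1.1 b.1.1.2, g x ^ q * w x := ENNReal.tsum_mul_left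
      _ = C * ENNReal.ofReal (6 ^ n) ^ q * C *
            ∫⁻ x in ⋃ b ∈ u, ball b.1.1 b.1.2, g x ^ q * w x := by
          rw [lintegral_biUnion hufin.countable (fun _ _ => measurableSet_ball)]
          exact fun a ha b hb hab =>
            (hud ha hb hab).mono ball_subset_closedBall ball_subset_closedBall
      _ ≤ _ := by gcongr; exact Measure.restrict_le_self
  have hE : levelSet g lam = ⋃ b ∈ T, ball b.1.1 b.1.2 := hTU.symm
  rw [hE]
  have := hT.to_subtype
  have hdir : Directed (· ⊆ ·) (fun F : Finset T => ⋃ b ∈ F, ball b.1.1.1 b.1.1.2) := by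
    intro F G
    exact ⟨F ∪ G, Set.biUnion_subset_biUnion_left (by intro x hx; exact Finset.mem_union_left _ hx),
      Set.biUnion_subset_biUnion_left (by intro x hx; exact Finset.mem_union_right _ hx)⟩
  have hU : (⋃ b ∈ T, ball b.1.1 b.1.2) = ⋃ F : Finset T, ⋃ b ∈ F, ball b.1.1.1 b.1.1.2 := by
    ext x
    simp only [Set.mem_iUnion]
    constructor
    · rintro ⟨b, hb, hx⟩
      exact ⟨{⟨b, hb⟩}, ⟨b, hb⟩, by simp, hx⟩
    · rintro ⟨F, b, -, hx⟩
      exact ⟨b.1, b.2, hx⟩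
  rw [hU, hdir.measure_iUnion, ENNReal.mul_iSup]
  refine iSup_le fun F => ?_
  refine le_trans ?_ (hfin (F.map (Function.Embedding.subtype _)))
  gcongr
  intro x
  simp only [Set.mem_iUnion]
  rintro ⟨b, hb, hx⟩
  exact ⟨b.1, by simpa using hb, hx⟩

/-- The large part of `f`. -/
def largePart {n : ℕ} (f : Rn n → ℝ) (k : ℤ) (x : Rn n) : ℝ≥0∞ :=
  if (2 : ℝ) ^ k / 2 < |f x| then ENNReal.ofReal |f x| else 0

lemma measurable_largePart {n : ℕ} {f : Rn n → ℝ} (hf : Measurable f) (k : ℤ) :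
    Measurable (largePart f k) := by
  unfold largePart
  exact Measurable.ite (measurableSet_lt measurable_const hf.abs) hf.abs.ennreal_ofReal
    measurable_const

lemma mem_levelSet {n : ℕ} {f : Rn n → ℝ} (hf : Measurable f) (k : ℤ) (x : Rn n)
    (hx : ENNReal.ofReal ((2 : ℝ) ^ k) < hlMaxE f x) :
    x ∈ levelSet (largePart f k) (ENNReal.ofReal ((2 : ℝ) ^ k / 2)) := by
  unfold hlMaxE at hx
  simp only [lt_iSup_iff] at hx
  obtain ⟨z, ρ, hρ, hxB, hlt⟩ := hx
  have hv0 : volume (ball z ρ) ≠ 0 := (measure_ball_pos volume z hρ).ne'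
  have hvt : volume (ball z ρ) ≠ ∞ := measure_ball_lt_top.ne
  rw [ENNReal.lt_div_iff_mul_lt (Or.inl hv0) (Or.inl hvt)] at hlt
  set L := ENNReal.ofReal ((2 : ℝ) ^ k / 2) with hL
  have h2 : ENNReal.ofReal ((2 : ℝ) ^ k) = L + L := by
    rw [hL, ← ENNReal.ofReal_add (by positivity) (by positivity)]; congr 1; ring
  have h3 : ∫⁻ y in ball z ρ, ENNReal.ofReal |f y| ≤
      (∫⁻ y in ball z ρ, largePart f k y) + L * volume (ball z ρ) := by
    rw [← setLIntegral_const, ← lintegral_add_left (measurable_largePart hf k)]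
    refine lintegral_mono fun y => ?_
    by_cases hy : (2 : ℝ) ^ k / 2 < |f y|
    · simp [largePart, hy]
    · simp only [largePart, hy, if_false, zero_add]
      exact ENNReal.ofReal_le_ofReal (not_lt.1 hy)
  rw [h2, add_mul] at hlt
  have h4 := lt_of_add_lt_add_right (hlt.trans_le h3)
  exact Set.mem_iUnion.2 ⟨⟨(z, ρ), hρ, h4⟩, hxB⟩

lemma pointwise_upper {Φ : ℝ → ℝ} (hΦ : IsOrliczFn Φ) {Cu pp : ℝ} (hCu : 0 < Cu)
    (hup : ∀ t s : ℝ, 0 ≤ t → 1 ≤ s → Φ (s * t) ≤ Cu * s ^ pp * Φ t) {y : ℝ} {m : ℤ}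
    (h1 : (2 : ℝ) ^ m < y) : Φ ((2 : ℝ) ^ (m + 1)) ≤ Cu * 2 ^ pp * Φ ((2 : ℝ) ^ m) := by
  have := hup ((2 : ℝ) ^ m) 2 (by positivity) (by norm_num)
  rwa [show (2 : ℝ) ^ (m + 1) = 2 * 2 ^ m by rw [zpow_add₀ (by norm_num)]; ring]

lemma pointwise_sum {Φ : ℝ → ℝ} (hΦ : IsOrliczFn Φ) {Cl Cu pm pp q : ℝ} (hCu : 0 < Cu)
    (hCl : 0 < Cl) (hq : 1 ≤ q)
    (hup : ∀ t s : ℝ, 0 ≤ t → 1 ≤ s → Φ (s * t) ≤ Cu * s ^ pp * Φ t)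
    (hlo : ∀ t s : ℝ, 0 ≤ t → 0 ≤ s → s ≤ 1 → Φ (s * t) ≤ Cl * s ^ pm * Φ t)
    (y : ℝ) (hy : 0 ≤ y) :
    ∑' k : ℤ, (ENNReal.ofReal ((2 : ℝ) ^ k / 2) ^ q)⁻¹ *
      ((if (2 : ℝ) ^ k / 2 < y then ENNReal.ofReal y else 0) ^ q *
        ENNReal.ofReal (Φ ((2 : ℝ) ^ k))) ≤
      (ENNReal.ofReal (2 ^ q * Cl * (Cu * 2 ^ pp)) *
        (1 - ENNReal.ofReal (2 ^ (q - pm)))⁻¹) * ENNReal.ofReal (Φ y) := by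
  have hq0 : 0 < q := by linarith
  have hnn : ∀ t, 0 ≤ t → 0 ≤ Φ t := fun t ht => by
    simpa [hΦ.map_zero] using hΦ.mono le_rfl ht
  rcases hy.eq_or_lt with rfl | hy
  · have : ∀ k : ℤ, ¬ ((2 : ℝ) ^ k / 2 < 0) := fun k => not_lt.2 (by positivity)
    simp [this, hq0]
  obtain ⟨m, hm1, hm2⟩ := exists_mem_Ioc_zpow hy (one_lt_two : (1 : ℝ) < 2)
  set T : ℤ → ℝ≥0∞ := fun k => (ENNReal.ofReal ((2 : ℝ) ^ k / 2) ^ q)⁻¹ *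
      ((if (2 : ℝ) ^ k / 2 < y then ENNReal.ofReal y else 0) ^ q *
        ENNReal.ofReal (Φ ((2 : ℝ) ^ k))) with hT
  have hzero : ∀ k, m + 1 < k → T k = 0 := by
    intro k hk
    have h1 : (2 : ℝ) ^ (m + 1 + 1) ≤ 2 ^ k := zpow_le_zpow_right₀ (by norm_num) (by omega)
    rw [zpow_add_one₀ (by norm_num)] at h1
    have : ¬ ((2 : ℝ) ^ k / 2 < y) := by linarith
    simp [hT, this, hq0]
  have hterm : ∀ j : ℕ, T (m + 1 - j) ≤
      ENNReal.ofReal (2 ^ q * Cl * (Cu * 2 ^ pp)) * ENNReal.ofReal (Φ y) *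
        ENNReal.ofReal (2 ^ (q - pm)) ^ j := by
    intro j
    have hj : (0 : ℝ) < 2 ^ j := by positivity
    have ek : (2 : ℝ) ^ (m + 1 - (j : ℤ)) = (2 ^ j)⁻¹ * 2 ^ (m + 1) := by
      rw [zpow_sub₀ (by norm_num), zpow_natCast]; field_simp
    have hpos : (0 : ℝ) < 2 ^ (m + 1 - (j : ℤ)) := by positivity
    have a1 : (y / ((2 : ℝ) ^ (m + 1 - (j : ℤ)) / 2)) ^ q ≤ 2 ^ q * (2 ^ j) ^ q := by
      rw [← Real.mul_rpow (by norm_num) hj.le]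
      apply Real.rpow_le_rpow (by positivity) _ hq0.le
      rw [div_le_iff₀ (by positivity), ek]
      calc y ≤ 2 ^ (m + 1) := hm2
        _ = _ := by field_simp
    have a2 : Φ ((2 : ℝ) ^ (m + 1 - (j : ℤ))) ≤
        Cl * ((2 ^ j)⁻¹) ^ pm * (Cu * 2 ^ pp * Φ y) := by
      rw [ek]
      refine (hlo _ _ (by positivity) (by positivity)
        (inv_le_one_of_one_le₀ (one_le_pow₀ (by norm_num)))).trans ?_
      gcongr
      refine (pointwise_upper hΦ hCu hup hm1).trans ?_
      gcongr
      exact hΦ.mono (by positivity) hm1.le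
    have a3 : ((2 : ℝ) ^ j) ^ q * ((2 ^ j)⁻¹) ^ pm = (2 ^ (q - pm)) ^ j := by
      rw [Real.inv_rpow hj.le, ← Real.rpow_neg hj.le, ← Real.rpow_add hj, ← sub_eq_add_neg,
        ← Real.rpow_natCast, ← Real.rpow_mul (by norm_num), ← Real.rpow_natCast,
        ← Real.rpow_mul (by norm_num), mul_comm]
    have a4 : T (m + 1 - j) ≤ ENNReal.ofReal ((y / ((2 : ℝ) ^ (m + 1 - (j : ℤ)) / 2)) ^ q *
        Φ ((2 : ℝ) ^ (m + 1 - (j : ℤ)))) := by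
      have hle : (if (2 : ℝ) ^ (m + 1 - (j : ℤ)) / 2 < y then ENNReal.ofReal y else 0) ≤
          ENNReal.ofReal y := by split_ifs <;> simp
      calc T (m + 1 - j) ≤ (ENNReal.ofReal ((2 : ℝ) ^ (m + 1 - (j : ℤ)) / 2) ^ q)⁻¹ *
            (ENNReal.ofReal y ^ q * ENNReal.ofReal (Φ ((2 : ℝ) ^ (m + 1 - (j : ℤ))))) := by
            simp only [hT]
            gcongr
        _ = _ := by
          rw [ENNReal.ofReal_rpow_of_pos (by positivity), ENNReal.ofReal_rpow_of_pos hy,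
            ← ENNReal.ofReal_inv_of_pos (by positivity), ← ENNReal.ofReal_mul (by positivity),
            ← ENNReal.ofReal_mul (by positivity), Real.div_rpow hy.le (by positivity)]
          congr 1
          ring
    refine a4.trans ?_
    rw [← ENNReal.ofReal_mul (by positivity), ← ENNReal.ofReal_pow (by positivity),
      ← ENNReal.ofReal_mul (mul_nonneg (by positivity) (hnn y hy.le))]
    apply ENNReal.ofReal_le_ofReal
    calc _ ≤ (2 ^ q * (2 ^ j) ^ q) * (Cl * ((2 ^ j)⁻¹) ^ pm * (Cu * 2 ^ pp * Φ y)) :=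
          mul_le_mul a1 a2 (hnn _ hpos.le) (by positivity)
      _ = 2 ^ q * Cl * (Cu * 2 ^ pp) * Φ y * ((2 ^ j) ^ q * ((2 ^ j)⁻¹) ^ pm) := by ring
      _ = _ := by rw [a3]
  have hsum : ∑' k, T k = ∑' j : ℕ, T (m + 1 - j) := by
    rw [← (Equiv.subLeft (m + 1)).tsum_eq T]
    symm
    apply Function.Injective.tsum_eq (f := fun k : ℤ => T (Equiv.subLeft (m + 1) k))
      (g := fun j : ℕ => (j : ℤ)) Nat.cast_injective
    intro k hk
    by_contra hcon
    apply hk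
    have : k < 0 := by
      by_contra h0
      exact hcon ⟨k.toNat, by simp; omega⟩
    exact hzero _ (by simp [Equiv.subLeft]; omega)
  rw [hsum]
  calc _ ≤ ∑' j : ℕ, ENNReal.ofReal (2 ^ q * Cl * (Cu * 2 ^ pp)) * ENNReal.ofReal (Φ y) *
        ENNReal.ofReal (2 ^ (q - pm)) ^ j := ENNReal.tsum_le_tsum hterm
    _ = _ := by rw [ENNReal.tsum_mul_left, ENNReal.tsum_geometric]; ring

lemma modular {n : ℕ} (φ : Rn n → ℝ → ℝ) (pm pp q : ℝ)
    (horlicz : ∀ x, IsOrliczFn (φ x)) (hmeas : ∀ t : ℝ, Measurable fun x => φ x t)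
    (hlow : UniformLowerType φ pm) (hupp : UniformUpperType φ pp)
    (hA : MemUniformA φ q) (hqm : q < pm) :
    ∃ C : ℝ, 0 < C ∧ ∀ f : Rn n → ℝ, Measurable f → ∀ h : Rn n → ℝ, (∀ x, 0 ≤ h x) →
      (∀ x, ENNReal.ofReal (h x) ≤ hlMaxE f x) →
      (∫⁻ x, ENNReal.ofReal (φ x (h x))) ≤ ENNReal.ofReal C * phiIntegral φ f := by
  obtain ⟨Cl, hCl, hlo⟩ := hlow
  obtain ⟨Cu, hCu, hup⟩ := hupp
  obtain ⟨hq, C, hC, H⟩ := strongA (fun x t ht => (horlicz x).pos t ht) hmeas hA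
  have hq0 : 0 < q := by linarith
  set A := C * ENNReal.ofReal (6 ^ n) ^ q * C with hAdef
  have hAtop : A ≠ ∞ := ENNReal.mul_ne_top (ENNReal.mul_ne_top hC
    (ENNReal.rpow_ne_top_of_nonneg hq0.le ENNReal.ofReal_ne_top)) hC
  set K := ENNReal.ofReal (2 ^ q * Cl * (Cu * 2 ^ pp)) *
        (1 - ENNReal.ofReal (2 ^ (q - pm)))⁻¹ with hK
  have hKtop : K ≠ ∞ := by
    refine ENNReal.mul_ne_top ENNReal.ofReal_ne_top ?_
    rw [ENNReal.inv_ne_top]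
    refine (tsub_pos_of_lt ?_).ne'
    rw [ENNReal.ofReal_lt_one]
    exact Real.rpow_lt_one_of_one_lt_of_neg (by norm_num) (by linarith)
  set D := ENNReal.ofReal (Cu * 2 ^ pp) * (A * K) with hD
  have hDtop : D ≠ ∞ := ENNReal.mul_ne_top ENNReal.ofReal_ne_top (ENNReal.mul_ne_top hAtop hKtop)
  refine ⟨D.toReal + 1, by positivity, fun f hf h h0 hM => ?_⟩
  have hDle : D ≤ ENNReal.ofReal (D.toReal + 1) := by
    rw [← ENNReal.ofReal_toReal hDtop]
    apply ENNReal.ofReal_le_ofReal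
    rw [ENNReal.toReal_ofReal (by positivity)]; linarith
  refine le_trans ?_ (mul_le_mul_left hDle _)
  set w : ℤ → Rn n → ℝ≥0∞ := fun k x => ENNReal.ofReal (φ x ((2 : ℝ) ^ k)) with hw
  have hwm : ∀ k, Measurable (w k) := fun k => (hmeas _).ennreal_ofReal
  set E : ℤ → Set (Rn n) := fun k => levelSet (largePart f k) (ENNReal.ofReal ((2 : ℝ) ^ k / 2))
    with hE
  have hEm : ∀ k, MeasurableSet (E k) := fun k => (isOpen_levelSet _ _).measurableSet
  have hptw : ∀ x, ENNReal.ofReal (φ x (h x)) ≤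
      ENNReal.ofReal (Cu * 2 ^ pp) * ∑' k, (E k).indicator (w k) x := by
    intro x
    rcases (h0 x).eq_or_lt with hx | hx
    · rw [← hx, (horlicz x).map_zero]; simp
    obtain ⟨m, hm1, hm2⟩ := exists_mem_Ioc_zpow hx (one_lt_two : (1 : ℝ) < 2)
    have hxE : x ∈ E m := by
      apply mem_levelSet hf
      exact lt_of_lt_of_le ((ENNReal.ofReal_lt_ofReal_iff hx).2 hm1) (hM x)
    calc ENNReal.ofReal (φ x (h x)) ≤ ENNReal.ofReal (Cu * 2 ^ pp * φ x ((2 : ℝ) ^ m)) :=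
          ENNReal.ofReal_le_ofReal (((horlicz x).mono hx.le hm2).trans
            (pointwise_upper (horlicz x) hCu (hup x) hm1))
      _ = ENNReal.ofReal (Cu * 2 ^ pp) * (E m).indicator (w m) x := by
          rw [ENNReal.ofReal_mul (by positivity), Set.indicator_of_mem hxE]
      _ ≤ _ := by gcongr; exact ENNReal.le_tsum m
  have hgm : ∀ k, Measurable fun x => (ENNReal.ofReal ((2 : ℝ) ^ k / 2) ^ q)⁻¹ *
      (largePart f k x ^ q * w k x) := fun k =>
    (((measurable_largePart hf k).pow_const q).mul (hwm k)).const_mul _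
  have hk : ∀ k, ∫⁻ x, (E k).indicator (w k) x ≤ A *
      ∫⁻ x, (ENNReal.ofReal ((2 : ℝ) ^ k / 2) ^ q)⁻¹ * (largePart f k x ^ q * w k x) := by
    intro k
    have h1 := weakType (w k) (hwm k) hq C (H ((2 : ℝ) ^ k) (by positivity))
      (largePart f k) (measurable_largePart hf k) (ENNReal.ofReal ((2 : ℝ) ^ k / 2))
    set L := ENNReal.ofReal ((2 : ℝ) ^ k / 2) ^ q with hL
    have hL0 : L ≠ 0 := (ENNReal.rpow_pos (ENNReal.ofReal_pos.2 (by positivity))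
      ENNReal.ofReal_ne_top).ne'
    have hLt : L ≠ ∞ := ENNReal.rpow_ne_top_of_nonneg hq0.le ENNReal.ofReal_ne_top
    rw [lintegral_indicator (hEm k), lintegral_const_mul' _ _ (ENNReal.inv_ne_top.2 hL0)]
    calc ∫⁻ x in E k, w k x = L⁻¹ * (L * ∫⁻ x in E k, w k x) := by
          rw [← mul_assoc, ENNReal.inv_mul_cancel hL0 hLt, one_mul]
      _ ≤ L⁻¹ * (A * ∫⁻ x, largePart f k x ^ q * w k x) := by gcongr
      _ = _ := by ring
  calc ∫⁻ x, ENNReal.ofReal (φ x (h x))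
      ≤ ∫⁻ x, ENNReal.ofReal (Cu * 2 ^ pp) * ∑' k, (E k).indicator (w k) x :=
        lintegral_mono hptw
    _ = ENNReal.ofReal (Cu * 2 ^ pp) * ∑' k, ∫⁻ x, (E k).indicator (w k) x := by
        rw [lintegral_const_mul' _ _ ENNReal.ofReal_ne_top,
          lintegral_tsum fun k => ((hwm k).indicator (hEm k)).aemeasurable]
    _ ≤ ENNReal.ofReal (Cu * 2 ^ pp) * ∑' k, A *
        ∫⁻ x, (ENNReal.ofReal ((2 : ℝ) ^ k / 2) ^ q)⁻¹ * (largePart f k x ^ q * w k x) := by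
        gcongr with k; exact hk k
    _ = ENNReal.ofReal (Cu * 2 ^ pp) * (A * ∫⁻ x, ∑' k : ℤ,
        (ENNReal.ofReal ((2 : ℝ) ^ k / 2) ^ q)⁻¹ * (largePart f k x ^ q * w k x)) := by
        rw [ENNReal.tsum_mul_left, lintegral_tsum fun k => (hgm k).aemeasurable]
    _ ≤ ENNReal.ofReal (Cu * 2 ^ pp) * (A * ∫⁻ x, K * ENNReal.ofReal (φ x |f x|)) := by
        gcongr with x
        exact pointwise_sum (horlicz x) hCu hCl hq (hup x) (hlo x) |f x| (abs_nonneg _)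
    _ = D * phiIntegral φ f := by
        rw [lintegral_const_mul' _ _ hKtop, hD, phiIntegral]; ring

lemma hlMax_nonneg {n : ℕ} (f : Rn n → ℝ) (x : Rn n) : 0 ≤ hlMax f x := by
  apply Real.sSup_nonneg
  rintro a ⟨z, ρ, -, -, rfl⟩
  exact ENNReal.toReal_nonneg

lemma hlMax_le_hlMaxE {n : ℕ} (f : Rn n → ℝ) (x : Rn n) :
    ENNReal.ofReal (hlMax f x) ≤ hlMaxE f x := by
  by_cases ht : hlMaxE f x = ∞
  · simp [ht]
  apply ENNReal.ofReal_le_of_le_toReal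
  apply Real.sSup_le _ ENNReal.toReal_nonneg
  rintro a ⟨z, ρ, hρ, hx, rfl⟩
  apply ENNReal.toReal_mono ht
  unfold hlMaxE
  exact le_iSup_of_le z (le_iSup_of_le ρ (le_iSup_of_le hρ (le_iSup_of_le hx le_rfl)))

lemma hlMaxE_scale {n : ℕ} (f : Rn n → ℝ) (x : Rn n) {c : ℝ} (hc : 0 < c) :
    ENNReal.ofReal (hlMax f x / c) ≤ hlMaxE (fun y => f y / c) x := by
  have h1 : ENNReal.ofReal (1 / c) * hlMaxE f x ≤ hlMaxE (fun y => f y / c) x := by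
    unfold hlMaxE
    simp only [ENNReal.mul_iSup]
    refine iSup_mono fun z => iSup_mono fun ρ => iSup_mono fun hρ => iSup_mono fun hx => ?_
    have : ∀ y, ENNReal.ofReal |f y / c| = ENNReal.ofReal (1 / c) * ENNReal.ofReal |f y| := by
      intro y
      rw [← ENNReal.ofReal_mul (by positivity), abs_div, abs_of_pos hc]
      congr 1; ring
    simp only [this]
    rw [lintegral_const_mul' _ _ ENNReal.ofReal_ne_top, mul_div_assoc]
  refine le_trans ?_ h1
  rw [show hlMax f x / c = 1 / c * hlMax f x by ring, ENNReal.ofReal_mul (by positivity)]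
  gcongr
  exact hlMax_le_hlMaxE f x

lemma scale_modular {n : ℕ} (φ : Rn n → ℝ → ℝ) {pm Cl : ℝ} (hpm : 1 ≤ pm) (hCl : 0 < Cl)
    (horlicz : ∀ x, IsOrliczFn (φ x))
    (hlo : ∀ (x : Rn n) (t s : ℝ), 0 ≤ t → 0 ≤ s → s ≤ 1 → φ x (s * t) ≤ Cl * s ^ pm * φ x t)
    (h : Rn n → ℝ) (h0 : ∀ x, 0 ≤ h x) {B D : ℝ} (hD : 1 ≤ D) (hDB : Cl * B ≤ D)
    (hB : ∫⁻ x, ENNReal.ofReal (φ x (h x)) ≤ ENNReal.ofReal B) :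
    ∫⁻ x, ENNReal.ofReal (φ x (h x / D)) ≤ 1 := by
  have hD0 : 0 < D := by linarith
  have hDi : D⁻¹ ^ pm ≤ D⁻¹ := by
    simpa using Real.rpow_le_rpow_of_exponent_ge (inv_pos.2 hD0) (inv_le_one_of_one_le₀ hD) hpm
  calc ∫⁻ x, ENNReal.ofReal (φ x (h x / D))
      ≤ ∫⁻ x, ENNReal.ofReal (Cl * D⁻¹) * ENNReal.ofReal (φ x (h x)) := by
        refine lintegral_mono fun x => ?_
        have hnn : 0 ≤ φ x (h x) := by
          simpa [(horlicz x).map_zero] using (horlicz x).mono le_rfl (h0 x)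
        rw [← ENNReal.ofReal_mul (by positivity)]
        apply ENNReal.ofReal_le_ofReal
        rw [div_eq_inv_mul]
        refine (hlo x (h x) D⁻¹ (h0 x) (by positivity) (inv_le_one_of_one_le₀ hD)).trans ?_
        gcongr
    _ = ENNReal.ofReal (Cl * D⁻¹) * ∫⁻ x, ENNReal.ofReal (φ x (h x)) :=
        lintegral_const_mul' _ _ ENNReal.ofReal_ne_top
    _ ≤ ENNReal.ofReal (Cl * D⁻¹) * ENNReal.ofReal B := by gcongr
    _ = ENNReal.ofReal (Cl * B / D) := by
        rw [← ENNReal.ofReal_mul (by positivity)]; congr 1; ring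
    _ ≤ 1 := by
        rw [ENNReal.ofReal_le_one, div_le_one hD0]; exact hDB

/-- Boundedness of the Hardy–Littlewood maximal function on `L^φ(ℝⁿ)` (Corollary 2.8). -/
theorem statement3 {n : ℕ} (φ : Rn n → ℝ → ℝ) (pm pp q : ℝ)
    (horlicz : ∀ x, IsOrliczFn (φ x)) (hmeas : ∀ t : ℝ, Measurable fun x => φ x t)
    (hlow : UniformLowerType φ pm) (hupp : UniformUpperType φ pp)
    (hA : MemUniformA φ q)
    (hqm : qIndex φ < pm) (hmp : pm ≤ pp) :
    ∃ C : ℝ, 0 < C ∧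
      (∀ f : Rn n → ℝ, Measurable f → MemLphi φ f →
        (∫⁻ x, ENNReal.ofReal (φ x (hlMax f x))) ≤ ENNReal.ofReal C * phiIntegral φ f) ∧
      ∀ f : Rn n → ℝ, Measurable f → MemLphi φ f →
        LuxNorm φ (fun x => hlMax f x) ≤ C * LuxNorm φ f := by
  obtain ⟨q₀, hq₀, hq₀m⟩ := exists_lt_of_csInf_lt ⟨q, hA⟩ hqm
  have hq1 : 1 ≤ q₀ := by
    rcases hq₀ with ⟨h, -⟩ | ⟨h, -⟩
    · exact h.ge
    · exact h.le
  obtain ⟨C, hC, hmod⟩ := modular φ pm pp q₀ horlicz hmeas hlow hupp hq₀ hq₀m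
  obtain ⟨Cl, hCl, hlo⟩ := hlow
  have hpm : 1 ≤ pm := by linarith
  set D := max (max 1 (Cl * C)) C with hD
  have hD1 : 1 ≤ D := (le_max_left _ _).trans (le_max_left _ _)
  have hD2 : Cl * C ≤ D := (le_max_right _ _).trans (le_max_left _ _)
  have hD3 : C ≤ D := le_max_right _ _
  have hD0 : 0 < D := by linarith
  refine ⟨D, hD0, fun f hf _ => ?_, fun f hf hfL => ?_⟩
  · refine (hmod f hf _ (hlMax_nonneg f) (hlMax_le_hlMaxE f)).trans ?_
    gcongr
  · unfold LuxNorm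
    set S := {c : ℝ | 0 < c ∧ (∫⁻ x, ENNReal.ofReal (φ x (|f x| / c))) ≤ 1} with hS
    have hne : S.Nonempty := by
      refine ⟨max 1 (Cl * (phiIntegral φ f).toReal), by positivity, ?_⟩
      apply scale_modular φ hpm hCl horlicz hlo (fun x => |f x|) (fun x => abs_nonneg _)
        (le_max_left _ _) (le_max_right _ _)
      rw [ENNReal.ofReal_toReal hfL.2.ne]
      exact le_rfl
    have key : ∀ c ∈ S, sInf {c : ℝ | 0 < c ∧
        (∫⁻ x, ENNReal.ofReal (φ x (|hlMax f x| / c))) ≤ 1} ≤ D * c := by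
      rintro c ⟨hc, hc1⟩
      apply csInf_le ⟨0, fun a ha => ha.1.le⟩
      refine ⟨by positivity, ?_⟩
      have h1 := hmod (fun y => f y / c) (hf.div_const c) (fun x => hlMax f x / c)
        (fun x => div_nonneg (hlMax_nonneg f x) hc.le) (fun x => hlMaxE_scale f x hc)
      have h2 : phiIntegral φ (fun y => f y / c) ≤ 1 := by
        unfold phiIntegral
        simpa only [abs_div, abs_of_pos hc] using hc1
      have h3 : ∫⁻ x, ENNReal.ofReal (φ x (hlMax f x / c)) ≤ ENNReal.ofReal C :=
        h1.trans (by simpa using mul_le_mul_right h2 (ENNReal.ofReal C))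
      have h4 := scale_modular φ hpm hCl horlicz hlo (fun x => hlMax f x / c)
        (fun x => div_nonneg (hlMax_nonneg f x) hc.le) hD1 hD2 h3
      refine le_trans (le_of_eq ?_) h4
      congr 1
      ext x
      rw [abs_of_nonneg (hlMax_nonneg f x), div_div, mul_comm c D]
    rw [← div_le_iff₀' hD0]
    apply le_csInf hne
    intro c hc
    rw [div_le_iff₀' hD0]
    exact key c hc
end
end

section
/- Let n ∈ ℕ and let φ : ℝ^n × [0,∞) → [0,∞) be uniformly locally integrable. If φ ∈ 𝔸_p(ℝ^n) for some p ∈ (1,∞), then there exists q ∈ (1,p) such that φ ∈ 𝔸_q(ℝ^n). -/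
open MeasureTheory Metric Filter
open scoped ENNReal NNReal Topology FourierTransform Classical

noncomputable section

/-! ### Dyadic cubes in `Fin n → ℝ` -/

def cubeQ {n : ℕ} (c : Fin n → ℝ) (r : ℝ) : Set (Fin n → ℝ) :=
  Set.univ.pi fun i => Set.Ico (c i) (c i + r)

def cubeChild {n : ℕ} (c : Fin n → ℝ) (r : ℝ) (s : Fin n → Bool) : Fin n → ℝ :=
  fun i => if s i then c i + r / 2 else c i

def cubeSel {n : ℕ} (c : Fin n → ℝ) (r : ℝ) (x : Fin n → ℝ) : Fin n → Bool :=
  fun i => decide (c i + r / 2 ≤ x i)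

def cubeAvg {n : ℕ} (σ : (Fin n → ℝ) → ℝ≥0∞) (c : Fin n → ℝ) (r : ℝ) : ℝ≥0∞ :=
  (∫⁻ x in cubeQ c r, σ x) / volume (cubeQ c r)

def dyAvg {n : ℕ} (σ : (Fin n → ℝ) → ℝ≥0∞) : ℕ → (Fin n → ℝ) → ℝ → (Fin n → ℝ) → ℝ≥0∞
  | 0, c, r, _ => cubeAvg σ c r
  | N + 1, c, r, x => dyAvg σ N (cubeChild c r (cubeSel c r x)) (r / 2) x

theorem cubeQ_meas {n : ℕ} (c : Fin n → ℝ) (r : ℝ) : MeasurableSet (cubeQ c r) :=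
  MeasurableSet.univ_pi fun _ => measurableSet_Ico

theorem cubeQ_vol {n : ℕ} (c : Fin n → ℝ) (r : ℝ) :
    volume (cubeQ c r) = ENNReal.ofReal r ^ n := by
  simp [cubeQ, Real.volume_pi_Ico]

theorem cubeQ_vol_ne_zero {n : ℕ} (c : Fin n → ℝ) {r : ℝ} (hr : 0 < r) :
    volume (cubeQ c r) ≠ 0 := by
  rw [cubeQ_vol]
  exact pow_ne_zero _ (by simpa using hr)

theorem cubeQ_vol_ne_top {n : ℕ} (c : Fin n → ℝ) (r : ℝ) :
    volume (cubeQ c r) ≠ ∞ := by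
  rw [cubeQ_vol]
  exact ENNReal.pow_ne_top ENNReal.ofReal_ne_top

theorem mem_cubeQ {n : ℕ} {c : Fin n → ℝ} {r : ℝ} {x : Fin n → ℝ} :
    x ∈ cubeQ c r ↔ ∀ i, c i ≤ x i ∧ x i < c i + r := by
  simp [cubeQ]

theorem cubeSel_of_mem {n : ℕ} {c : Fin n → ℝ} {r : ℝ} {s : Fin n → Bool} {x : Fin n → ℝ}
    (hx : x ∈ cubeQ (cubeChild c r s) (r / 2)) : cubeSel c r x = s := by
  rw [mem_cubeQ] at hx
  funext i
  have := hx i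
  unfold cubeChild at this
  unfold cubeSel
  cases h : s i
  · simp only [h] at this
    simp only [decide_eq_false_iff_not, not_le]
    simpa using this.2
  · simp only [h] at this
    simp only [decide_eq_true_eq]
    simpa using this.1

theorem mem_child_sel {n : ℕ} {c : Fin n → ℝ} {r : ℝ} {x : Fin n → ℝ}
    (hx : x ∈ cubeQ c r) : x ∈ cubeQ (cubeChild c r (cubeSel c r x)) (r / 2) := by
  rw [mem_cubeQ] at hx ⊢
  intro i
  have := hx i
  by_cases h : c i + r / 2 ≤ x i
  · have e : cubeChild c r (cubeSel c r x) i = c i + r / 2 := by simp [cubeChild, cubeSel, h]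
    rw [e]
    constructor <;> linarith
  · have e : cubeChild c r (cubeSel c r x) i = c i := by simp [cubeChild, cubeSel, h]
    rw [e]
    constructor <;> linarith

theorem child_subset {n : ℕ} {c : Fin n → ℝ} {r : ℝ} (hr : 0 < r) (s : Fin n → Bool) :
    cubeQ (cubeChild c r s) (r / 2) ⊆ cubeQ c r := by
  intro x hx
  rw [mem_cubeQ] at hx ⊢
  intro i
  have := hx i
  unfold cubeChild at this
  split_ifs at this <;> constructor <;> linarith

theorem cubeQ_eq_iUnion {n : ℕ} {c : Fin n → ℝ} {r : ℝ} (hr : 0 < r) :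
    cubeQ c r = ⋃ s, cubeQ (cubeChild c r s) (r / 2) := by
  apply Set.Subset.antisymm
  · intro x hx
    exact Set.mem_iUnion.2 ⟨_, mem_child_sel hx⟩
  · exact Set.iUnion_subset fun s => child_subset hr s

theorem child_disjoint {n : ℕ} {c : Fin n → ℝ} {r : ℝ} :
    Pairwise (Function.onFun Disjoint fun s => cubeQ (cubeChild c r s) (r / 2)) := by
  intro s s' hs
  refine Set.disjoint_left.2 fun x hx hx' => hs ?_
  rw [← cubeSel_of_mem hx, ← cubeSel_of_mem hx']

theorem lintegral_children {n : ℕ} {c : Fin n → ℝ} {r : ℝ} (hr : 0 < r)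
    (f : (Fin n → ℝ) → ℝ≥0∞) :
    ∫⁻ x in cubeQ c r, f x = ∑ s, ∫⁻ x in cubeQ (cubeChild c r s) (r / 2), f x := by
  rw [cubeQ_eq_iUnion hr, lintegral_iUnion (fun s => cubeQ_meas _ _) child_disjoint, tsum_fintype]

theorem cubeSel_meas {n : ℕ} (c : Fin n → ℝ) (r : ℝ) : Measurable (cubeSel c r) := by
  rw [measurable_pi_iff]
  intro i
  refine measurable_to_bool ?_
  have : (fun x => cubeSel c r x i) ⁻¹' {true} = {x | c i + r / 2 ≤ x i} := by
    ext x; simp [cubeSel]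
  rw [this]
  exact measurableSet_le measurable_const (measurable_pi_apply i)

theorem dyAvg_meas {n : ℕ} (σ : (Fin n → ℝ) → ℝ≥0∞) (N : ℕ) :
    ∀ c r, Measurable (dyAvg σ N c r) := by
  induction N with
  | zero => intro c r; exact measurable_const
  | succ N ih =>
    intro c r
    have h : Measurable (fun q : (Fin n → Bool) × (Fin n → ℝ) =>
        dyAvg σ N (cubeChild c r q.1) (r / 2) q.2) :=
      measurable_from_prod_countable_right fun s => ih (cubeChild c r s) (r / 2)
    exact h.comp ((cubeSel_meas c r).prodMk measurable_id)

theorem dyAvg_spec {n : ℕ} (σ : (Fin n → ℝ) → ℝ≥0∞) (N : ℕ) :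
    ∀ c r x, 0 < r → x ∈ cubeQ c r → ∃ c', x ∈ cubeQ c' (r / 2 ^ N) ∧
      cubeQ c' (r / 2 ^ N) ⊆ cubeQ c r ∧ dyAvg σ N c r x = cubeAvg σ c' (r / 2 ^ N) := by
  induction N with
  | zero => intro c r x hr hx; exact ⟨c, by simpa using hx, by simp, by simp [dyAvg]⟩
  | succ N ih =>
    intro c r x hr hx
    obtain ⟨c', h1, h2, h3⟩ := ih (cubeChild c r (cubeSel c r x)) (r / 2) x (by positivity)
      (mem_child_sel hx)
    have e : r / 2 / 2 ^ N = r / 2 ^ (N + 1) := by rw [pow_succ]; field_simp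
    rw [e] at h1 h2 h3
    exact ⟨c', h1, h2.trans (child_subset hr _), h3⟩

theorem lintegral_dyAvg_succ {n : ℕ} (σ : (Fin n → ℝ) → ℝ≥0∞) (N : ℕ) {c : Fin n → ℝ} {r : ℝ}
    (hr : 0 < r) (e : ℝ) :
    ∫⁻ x in cubeQ c r, dyAvg σ (N + 1) c r x ^ e =
      ∑ s, ∫⁻ x in cubeQ (cubeChild c r s) (r / 2), dyAvg σ N (cubeChild c r s) (r / 2) x ^ e := by
  rw [lintegral_children hr]
  refine Finset.sum_congr rfl fun s _ => ?_
  refine setLIntegral_congr_fun (cubeQ_meas _ _) fun x hx => ?_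
  simp only [dyAvg, cubeSel_of_mem hx]

theorem cubeAvg_mul {n : ℕ} (σ : (Fin n → ℝ) → ℝ≥0∞) (c : Fin n → ℝ) {r : ℝ} (hr : 0 < r) :
    cubeAvg σ c r * volume (cubeQ c r) = ∫⁻ x in cubeQ c r, σ x :=
  ENNReal.div_mul_cancel (cubeQ_vol_ne_zero c hr) (cubeQ_vol_ne_top c r)

theorem child_vol {n : ℕ} (c c' : Fin n → ℝ) {r : ℝ} :
    volume (cubeQ c r) = 2 ^ n * volume (cubeQ c' (r / 2)) := by
  rw [cubeQ_vol, cubeQ_vol, ← mul_pow]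
  congr 1
  rw [show (2 : ℝ≥0∞) = ENNReal.ofReal 2 by simp, ← ENNReal.ofReal_mul (by norm_num)]
  congr 1; ring

theorem child_avg_le {n : ℕ} (σ : (Fin n → ℝ) → ℝ≥0∞) (c : Fin n → ℝ) {r : ℝ} (hr : 0 < r)
    (s : Fin n → Bool) : cubeAvg σ (cubeChild c r s) (r / 2) ≤ 2 ^ n * cubeAvg σ c r := by
  have h0 := cubeQ_vol_ne_zero (cubeChild c r s) (r := r / 2) (by positivity)
  have h1 := cubeQ_vol_ne_top (cubeChild c r s) (r / 2)
  rw [cubeAvg, ENNReal.div_le_iff h0 h1]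
  calc _ ≤ ∫⁻ x in cubeQ c r, σ x := lintegral_mono_set (child_subset hr s)
    _ = cubeAvg σ c r * volume (cubeQ c r) := (cubeAvg_mul σ c hr).symm
    _ = _ := by rw [child_vol c (cubeChild c r s)]; ring

theorem dyAvg_inner {n : ℕ} (σ : (Fin n → ℝ) → ℝ≥0∞) (ε : ℝ) (hε : 0 < ε)
    (G Λ : ℝ≥0∞) (N : ℕ)
    (hN : ∀ M < N, ∀ c r, 0 < r → ∫⁻ x in cubeQ c r, dyAvg σ M c r x ^ (1 + ε) ≤
      G * cubeAvg σ c r ^ ε * ∫⁻ x in cubeQ c r, σ x) :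
    ∀ M ≤ N, ∀ c r, 0 < r → cubeAvg σ c r ≤ Λ → ∃ U ⊆ cubeQ c r, MeasurableSet U ∧
      Λ * volume U ≤ ∫⁻ x in U, σ x ∧
      ∫⁻ x in cubeQ c r, dyAvg σ M c r x ^ (1 + ε) ≤
        Λ ^ ε * (∫⁻ x in cubeQ c r, σ x) + G * (2 ^ n * Λ) ^ ε * ∫⁻ x in U, σ x := by
  intro M
  induction M with
  | zero =>
    intro _ c r hr hΛ
    refine ⟨∅, Set.empty_subset _, MeasurableSet.empty, by simp, ?_⟩
    simp only [dyAvg, lintegral_const, Measure.restrict_apply MeasurableSet.univ, Set.univ_inter,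
      Measure.restrict_empty, lintegral_zero_measure, mul_zero, add_zero]
    rw [ENNReal.rpow_add_of_nonneg _ _ zero_le_one hε.le, ENNReal.rpow_one, mul_right_comm,
      cubeAvg_mul σ c hr, mul_comm]
    gcongr
  | succ M ih =>
    intro hM c r hr hΛ
    have hr2 : 0 < r / 2 := by positivity
    have key : ∀ s : Fin n → Bool, ∃ U ⊆ cubeQ (cubeChild c r s) (r / 2), MeasurableSet U ∧
      Λ * volume U ≤ ∫⁻ x in U, σ x ∧
      ∫⁻ x in cubeQ (cubeChild c r s) (r / 2), dyAvg σ M (cubeChild c r s) (r / 2) x ^ (1 + ε) ≤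
        Λ ^ ε * (∫⁻ x in cubeQ (cubeChild c r s) (r / 2), σ x) +
          G * (2 ^ n * Λ) ^ ε * ∫⁻ x in U, σ x := by
      intro s
      by_cases h : cubeAvg σ (cubeChild c r s) (r / 2) ≤ Λ
      · exact ih (by omega) _ _ hr2 h
      · push Not at h
        refine ⟨_, subset_rfl, cubeQ_meas _ _, ?_, ?_⟩
        · rw [← cubeAvg_mul σ _ hr2]
          gcongr
        · refine (hN M (by omega) _ _ hr2).trans (le_trans ?_ le_add_self)
          gcongr
          exact (child_avg_le σ c hr s).trans (by gcongr)
    choose U hU1 hU2 hU3 hU4 using key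
    have hdis : Pairwise (Function.onFun Disjoint U) := fun s s' h =>
      (child_disjoint (c := c) (r := r) h).mono (hU1 s) (hU1 s')
    refine ⟨⋃ s, U s, Set.iUnion_subset fun s => (hU1 s).trans (child_subset hr s),
      MeasurableSet.iUnion hU2, ?_, ?_⟩
    · rw [lintegral_iUnion hU2 hdis, measure_iUnion hdis hU2, tsum_fintype, tsum_fintype,
        Finset.mul_sum]
      exact Finset.sum_le_sum fun s _ => hU3 s
    · rw [lintegral_dyAvg_succ σ M hr, lintegral_children hr σ, lintegral_iUnion hU2 hdis,
        tsum_fintype, Finset.mul_sum, Finset.mul_sum, ← Finset.sum_add_distrib]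
      exact Finset.sum_le_sum fun s _ => hU4 s

theorem dyAvg_outer {n : ℕ} (σ : (Fin n → ℝ) → ℝ≥0∞) (ε : ℝ) (hε : 0 < ε)
    (hfin : ∀ c r, 0 < r → ∫⁻ x in cubeQ c r, σ x ≠ ∞)
    (G β : ℝ≥0∞) (hG : 2 ^ ε + G * (2 ^ n * 2) ^ ε * β ≤ G)
    (hβ : ∀ c r, 0 < r → ∀ U ⊆ cubeQ c r, MeasurableSet U → 2 * volume U ≤ volume (cubeQ c r) →
      ∫⁻ x in U, σ x ≤ β * ∫⁻ x in cubeQ c r, σ x) (N : ℕ) :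
    ∀ c r, 0 < r → ∫⁻ x in cubeQ c r, dyAvg σ N c r x ^ (1 + ε) ≤
      G * cubeAvg σ c r ^ ε * ∫⁻ x in cubeQ c r, σ x := by
  induction N using Nat.strong_induction_on with
  | _ N ih =>
    intro c r hr
    have hA : cubeAvg σ c r ≠ ∞ := ENNReal.div_ne_top (hfin c r hr) (cubeQ_vol_ne_zero c hr)
    obtain ⟨U, hU1, hU2, hU3, hU4⟩ := dyAvg_inner σ ε hε G (2 * cubeAvg σ c r) N ih N le_rfl
      c r hr (by rw [two_mul]; exact le_self_add)
    have hUQ : ∫⁻ x in U, σ x ≤ ∫⁻ x in cubeQ c r, σ x := lintegral_mono_set hU1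
    have hUβ : ∫⁻ x in U, σ x ≤ β * ∫⁻ x in cubeQ c r, σ x := by
      by_cases h0 : cubeAvg σ c r = 0
      · have : ∫⁻ x in cubeQ c r, σ x = 0 := by rw [← cubeAvg_mul σ c hr, h0, zero_mul]
        rw [this] at hUQ ⊢
        simpa using hUQ
      · refine hβ c r hr U hU1 hU2 ?_
        have := hU3.trans hUQ
        rw [← cubeAvg_mul σ c hr, mul_right_comm, mul_comm] at this
        exact (ENNReal.mul_le_mul_iff_right h0 hA).1 this
    calc _ ≤ _ := hU4
      _ ≤ (2 * cubeAvg σ c r) ^ ε * (∫⁻ x in cubeQ c r, σ x) +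
          G * (2 ^ n * (2 * cubeAvg σ c r)) ^ ε * (β * ∫⁻ x in cubeQ c r, σ x) := by gcongr
      _ = (2 ^ ε + G * (2 ^ n * 2) ^ ε * β) * (cubeAvg σ c r ^ ε * ∫⁻ x in cubeQ c r, σ x) := by
          rw [← mul_assoc (2 ^ n), ENNReal.mul_rpow_of_nonneg _ _ hε.le,
            ENNReal.mul_rpow_of_nonneg (2 ^ n * 2) _ hε.le]
          ring
      _ ≤ G * (cubeAvg σ c r ^ ε * ∫⁻ x in cubeQ c r, σ x) := by gcongr
      _ = _ := by ring

theorem cubeQ_ae {n : ℕ} (c : Fin n → ℝ) {r : ℝ} (hr : 0 < r) :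
    cubeQ c r =ᵐ[volume] closedBall (fun i => c i + r / 2) (r / 2) := by
  have h := Measure.univ_pi_Ico_ae_eq_Icc (μ := fun _ : Fin n => (volume : Measure ℝ))
    (f := c) (g := fun i => c i + r)
  have e : closedBall (fun i => c i + r / 2) (r / 2) = Set.Icc c fun i => c i + r := by
    ext x
    rw [mem_closedBall, dist_pi_le_iff (by positivity), Set.mem_Icc, Pi.le_def, Pi.le_def,
      ← forall_and]
    refine forall_congr' fun i => ?_
    rw [Real.dist_eq, abs_le]
    constructor <;> rintro ⟨h1, h2⟩ <;> constructor <;> linarith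
  rw [e]
  exact h

theorem dyAvg_tendsto {n : ℕ} (σ : (Fin n → ℝ) → ℝ≥0∞) (hσ : Measurable σ)
    {c : Fin n → ℝ} {r : ℝ} (hr : 0 < r) (hfin : ∫⁻ x in cubeQ c r, σ x ≠ ∞) :
    ∀ᵐ x ∂(volume.restrict (cubeQ c r)),
      Tendsto (fun N => dyAvg σ N c r x) atTop (𝓝 (σ x)) := by
  rw [ae_restrict_iff' (cubeQ_meas c r)]
  have hf : ∫⁻ x, (cubeQ c r).indicator σ x ≠ ∞ := by
    rwa [lintegral_indicator (cubeQ_meas c r)]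
  filter_upwards [(IsUnifLocDoublingMeasure.vitaliFamily
    (volume : Measure (Fin n → ℝ)) 1).ae_tendsto_lintegral_div'
      (hσ.indicator (cubeQ_meas c r)) hf] with x hx hxQ
  rw [Set.indicator_of_mem hxQ] at hx
  choose c' h1 h2 h3 using fun N => dyAvg_spec σ N c r x hr hxQ
  have hpos : ∀ N : ℕ, 0 < r / 2 ^ N := fun N => by positivity
  have hδ : Tendsto (fun N : ℕ => r / 2 ^ N / 2) atTop (𝓝[>] 0) := by
    rw [tendsto_nhdsWithin_iff]
    constructor
    · have : Tendsto (fun N : ℕ => (r / 2) * (1 / 2 : ℝ) ^ N) atTop (𝓝 ((r / 2) * 0)) :=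
        (tendsto_pow_atTop_nhds_zero_of_lt_one (by norm_num) (by norm_num)).const_mul _
      rw [mul_zero] at this
      refine this.congr fun N => ?_
      rw [one_div, inv_pow]; field_simp
    · exact Eventually.of_forall fun N => by have := hpos N; simp only [Set.mem_Ioi]; positivity
  have ht := IsUnifLocDoublingMeasure.tendsto_closedBall_filterAt
    (volume : Measure (Fin n → ℝ)) (K := 1) (x := x)
    (fun N i => c' N i + r / 2 ^ N / 2) (fun N => r / 2 ^ N / 2) hδ
    (Eventually.of_forall fun N => by
      rw [one_mul, mem_closedBall, dist_pi_le_iff (by have := hpos N; positivity)]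
      intro i
      have := mem_cubeQ.1 (h1 N) i
      rw [Real.dist_eq, abs_le]
      constructor <;> linarith)
  refine (hx.comp ht).congr fun N => ?_
  rw [h3 N, cubeAvg, Function.comp]
  rw [← measure_congr (cubeQ_ae (c' N) (hpos N)),
    ← Measure.restrict_congr_set (cubeQ_ae (c' N) (hpos N))]
  congr 1
  exact setLIntegral_congr_fun (cubeQ_meas _ _) fun y hy => Set.indicator_of_mem (h2 N hy) σ

/-- Reverse Hölder inequality on cubes. -/
theorem reverse_holder_cube {n : ℕ} (σ : (Fin n → ℝ) → ℝ≥0∞) (hσ : Measurable σ)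
    (ε : ℝ) (hε : 0 < ε)
    (hfin : ∀ c r, 0 < r → ∫⁻ x in cubeQ c r, σ x ≠ ∞)
    (G β : ℝ≥0∞) (hG : 2 ^ ε + G * (2 ^ n * 2) ^ ε * β ≤ G)
    (hβ : ∀ c r, 0 < r → ∀ U ⊆ cubeQ c r, MeasurableSet U → 2 * volume U ≤ volume (cubeQ c r) →
      ∫⁻ x in U, σ x ≤ β * ∫⁻ x in cubeQ c r, σ x)
    (c : Fin n → ℝ) {r : ℝ} (hr : 0 < r) :
    ∫⁻ x in cubeQ c r, σ x ^ (1 + ε) ≤ G * cubeAvg σ c r ^ ε * ∫⁻ x in cubeQ c r, σ x := by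
  calc ∫⁻ x in cubeQ c r, σ x ^ (1 + ε)
      = ∫⁻ x in cubeQ c r, liminf (fun N => dyAvg σ N c r x ^ (1 + ε)) atTop := by
        refine lintegral_congr_ae ?_
        filter_upwards [dyAvg_tendsto σ hσ hr (hfin c r hr)] with x hx
        exact (((ENNReal.continuous_rpow_const (y := 1 + ε)).tendsto _).comp hx).liminf_eq.symm
    _ ≤ liminf (fun N => ∫⁻ x in cubeQ c r, dyAvg σ N c r x ^ (1 + ε)) atTop :=
        lintegral_liminf_le fun N => (dyAvg_meas σ N c r).pow_const _
    _ ≤ _ := by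
        refine liminf_le_of_le (by isBoundedDefault) fun b hb => ?_
        obtain ⟨N, hN⟩ := hb.exists
        exact hN.trans (dyAvg_outer σ ε hε hfin G β hG hβ N c r hr)

theorem exists_eps_G (n : ℕ) (β : ℝ) (hβ0 : 0 ≤ β) (hβ : β < 1) :
    ∃ (ε : ℝ) (G : ℝ≥0∞), 0 < ε ∧ G ≠ ∞ ∧
      2 ^ ε + G * (2 ^ n * 2) ^ ε * ENNReal.ofReal β ≤ G := by
  have hb : (0 : ℝ) < 2 ^ n * 2 := by positivity
  have ht : Tendsto (fun ε : ℝ => ((2 : ℝ) ^ n * 2) ^ ε * β) (𝓝[>] 0) (𝓝 β) := by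
    have : ContinuousAt (fun ε : ℝ => ((2 : ℝ) ^ n * 2) ^ ε * β) 0 :=
      (Real.continuousAt_const_rpow hb.ne').mul continuousAt_const
    have h2 := this.tendsto
    simp only [Real.rpow_zero, one_mul] at h2
    exact h2.mono_left nhdsWithin_le_nhds
  obtain ⟨ε, h1, hε⟩ := ((ht.eventually_lt_const (show β < (1 + β) / 2 by linarith)).and
    self_mem_nhdsWithin).exists
  have hε : 0 < ε := hε
  set γ := ((2 : ℝ) ^ n * 2) ^ ε * β with hγ
  have hγ1 : 0 < 1 - γ := by linarith
  have hγ0 : 0 ≤ γ := by positivity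
  refine ⟨ε, ENNReal.ofReal (2 ^ ε / (1 - γ)), hε, ENNReal.ofReal_ne_top, ?_⟩
  have e1 : (2 : ℝ≥0∞) ^ ε = ENNReal.ofReal (2 ^ ε) := by
    rw [← ENNReal.ofReal_rpow_of_nonneg (by norm_num) hε.le]; simp
  have e2 : ((2 : ℝ≥0∞) ^ n * 2) ^ ε = ENNReal.ofReal ((2 ^ n * 2) ^ ε) := by
    rw [← ENNReal.ofReal_rpow_of_nonneg hb.le hε.le, ENNReal.ofReal_mul (by positivity),
      ENNReal.ofReal_pow (by norm_num)]
    simp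
  rw [e1, e2, mul_assoc, ← ENNReal.ofReal_mul (by positivity), ← hγ,
    ← ENNReal.ofReal_mul (by positivity), ← ENNReal.ofReal_add (by positivity) (by positivity)]
  apply ENNReal.ofReal_le_ofReal
  apply le_of_eq
  field_simp
  ring

theorem holder_vol {n : ℕ} (w : (Fin n → ℝ) → ℝ≥0∞) (hw : Measurable w) (hwt : ∀ x, w x ≠ ∞)
    (p : ℝ) (hp : 1 < p) (E : Set (Fin n → ℝ))
    (hfin : ∫⁻ x in E, w x ^ (-(1 / (p - 1))) ≠ ∞) :
    volume E ^ p ≤ (∫⁻ x in E, w x) * (∫⁻ x in E, w x ^ (-(1 / (p - 1)))) ^ (p - 1) := by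
  have hp0 : 0 < p := by linarith
  have hp1 : 0 < p - 1 := by linarith
  have hσm : Measurable fun x => w x ^ (-(1 / (p - 1))) := hw.pow_const _
  have hconj : p.HolderConjugate (p / (p - 1)) := Real.HolderConjugate.conjExponent hp
  have h := ENNReal.lintegral_mul_le_Lp_mul_Lq (volume.restrict E) hconj
    (f := fun x => w x ^ (1 / p)) (g := fun x => w x ^ (-(1 / p)))
    (hw.pow_const _).aemeasurable (hw.pow_const _).aemeasurable
  have h1 : ∫⁻ x in E, ((fun x => w x ^ (1 / p)) * fun x => w x ^ (-(1 / p))) x = volume E := by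
    rw [← setLIntegral_one]
    refine lintegral_congr_ae ?_
    filter_upwards [ae_lt_top hσm hfin] with x hx
    have hx0 : w x ≠ 0 := by
      intro h0
      rw [h0, ENNReal.zero_rpow_of_neg (by simpa using hp1)] at hx
      exact lt_irrefl _ hx
    simp only [Pi.mul_apply]
    rw [← ENNReal.rpow_add _ _ hx0 (hwt x)]
    simp
  rw [h1] at h
  have e1 : ∀ x, (w x ^ (1 / p)) ^ p = w x := fun x => by
    rw [← ENNReal.rpow_mul, one_div, inv_mul_cancel₀ hp0.ne', ENNReal.rpow_one]
  have e2 : ∀ x, (w x ^ (-(1 / p))) ^ (p / (p - 1)) = w x ^ (-(1 / (p - 1))) := fun x => by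
    rw [← ENNReal.rpow_mul]; congr 1; field_simp
  simp only [e1, e2] at h
  calc volume E ^ p ≤ _ := ENNReal.rpow_le_rpow h hp0.le
    _ = _ := by
      rw [ENNReal.mul_rpow_of_nonneg _ _ hp0.le, ← ENNReal.rpow_mul, ← ENNReal.rpow_mul]
      congr 2
      · rw [one_div, inv_mul_cancel₀ hp0.ne', ENNReal.rpow_one]
      · field_simp

theorem cube_Ainfty {n : ℕ} (w : (Fin n → ℝ) → ℝ≥0∞) (hw : Measurable w) (hwt : ∀ x, w x ≠ ∞)
    (p : ℝ) (hp : 1 < p) (C : ℝ≥0∞) (D : ℝ≥0) (hD : 1 ≤ D) (hCD : 2 ^ p * C ≤ (D : ℝ≥0∞) ^ (p - 1))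
    (c : Fin n → ℝ) (r : ℝ) (hr : 0 < r)
    (hA : (∫⁻ x in cubeQ c r, w x) * (∫⁻ x in cubeQ c r, w x ^ (-(1 / (p - 1)))) ^ (p - 1) ≤
      C * volume (cubeQ c r) ^ p)
    (hfin : ∫⁻ x in cubeQ c r, w x ^ (-(1 / (p - 1))) ≠ ∞)
    (U : Set (Fin n → ℝ)) (hU : U ⊆ cubeQ c r) (hUm : MeasurableSet U)
    (hUv : 2 * volume U ≤ volume (cubeQ c r)) :
    ∫⁻ x in U, w x ^ (-(1 / (p - 1))) ≤
      ENNReal.ofReal (1 - 1 / (D : ℝ)) * ∫⁻ x in cubeQ c r, w x ^ (-(1 / (p - 1))) := by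
  set σ := fun x => w x ^ (-(1 / (p - 1))) with hσ
  have hp0 : 0 < p := by linarith
  have hp1 : 0 < p - 1 := by linarith
  set E := cubeQ c r \ U with hE
  have hEQ : E ⊆ cubeQ c r := Set.sdiff_subset
  have hEm : MeasurableSet E := (cubeQ_meas c r).diff hUm
  have hsplit : ∀ μ : Measure (Fin n → ℝ), ∀ f : (Fin n → ℝ) → ℝ≥0∞,
      ∫⁻ x in cubeQ c r, f x ∂μ = ∫⁻ x in U, f x ∂μ + ∫⁻ x in E, f x ∂μ := by
    intro μ f
    rw [← lintegral_union hEm Set.disjoint_sdiff_right, hE, Set.union_sdiff_cancel hU]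
  have hvsplit : volume (cubeQ c r) = volume U + volume E := by
    have := hsplit volume 1
    simpa using this
  have hUfin : volume U ≠ ∞ := ne_top_of_le_ne_top (cubeQ_vol_ne_top c r) (measure_mono hU)
  have hQE : volume (cubeQ c r) ≤ 2 * volume E := by
    rw [hvsplit, two_mul] at hUv
    have h3 : volume U ≤ volume E := (ENNReal.add_le_add_iff_left hUfin).1 hUv
    rw [hvsplit, two_mul]; gcongr
  have hσE : ∫⁻ x in E, σ x ≤ ∫⁻ x in cubeQ c r, σ x := lintegral_mono_set hEQ
  have hσEfin := ne_top_of_le_ne_top hfin hσE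
  have hH := holder_vol w hw hwt p hp E hσEfin
  have hV0 : volume (cubeQ c r) ^ p ≠ 0 := by
    simp [ENNReal.rpow_eq_zero_iff, cubeQ_vol_ne_zero c hr, hp0.le]
  have hVt : volume (cubeQ c r) ^ p ≠ ∞ :=
    ENNReal.rpow_ne_top_of_nonneg hp0.le (cubeQ_vol_ne_top c r)
  have hkey : (∫⁻ x in cubeQ c r, σ x) ^ (p - 1) ≤ (D * ∫⁻ x in E, σ x) ^ (p - 1) := by
    rw [← ENNReal.mul_le_mul_iff_right hV0 hVt]
    calc volume (cubeQ c r) ^ p * (∫⁻ x in cubeQ c r, σ x) ^ (p - 1)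
        ≤ (2 * volume E) ^ p * (∫⁻ x in cubeQ c r, σ x) ^ (p - 1) := by gcongr
      _ = 2 ^ p * volume E ^ p * (∫⁻ x in cubeQ c r, σ x) ^ (p - 1) := by
        rw [ENNReal.mul_rpow_of_nonneg _ _ hp0.le]
      _ ≤ 2 ^ p * ((∫⁻ x in cubeQ c r, w x) * (∫⁻ x in E, σ x) ^ (p - 1)) *
          (∫⁻ x in cubeQ c r, σ x) ^ (p - 1) := by
        gcongr
        refine hH.trans ?_
        gcongr
      _ = 2 ^ p * ((∫⁻ x in cubeQ c r, w x) * (∫⁻ x in cubeQ c r, σ x) ^ (p - 1)) *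
          (∫⁻ x in E, σ x) ^ (p - 1) := by ring
      _ ≤ 2 ^ p * (C * volume (cubeQ c r) ^ p) * (∫⁻ x in E, σ x) ^ (p - 1) := by gcongr
      _ = volume (cubeQ c r) ^ p * ((2 ^ p * C) * (∫⁻ x in E, σ x) ^ (p - 1)) := by ring
      _ ≤ volume (cubeQ c r) ^ p * ((D : ℝ≥0∞) ^ (p - 1) * (∫⁻ x in E, σ x) ^ (p - 1)) := by
        gcongr
      _ = _ := by rw [ENNReal.mul_rpow_of_nonneg _ _ hp1.le]
  have hle : ∫⁻ x in cubeQ c r, σ x ≤ D * ∫⁻ x in E, σ x :=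
    (ENNReal.rpow_le_rpow_iff hp1).1 hkey
  have hσU := ne_top_of_le_ne_top hfin (lintegral_mono_set (f := σ) (μ := volume) hU)
  have hs := hsplit volume σ
  rw [hs] at hle ⊢
  lift ∫⁻ x in U, σ x to ℝ≥0 using hσU with a
  lift ∫⁻ x in E, σ x to ℝ≥0 using hσEfin with b
  have hDr : (1 : ℝ) ≤ D := by exact_mod_cast hD
  have hle' : (a : ℝ) + b ≤ D * b := by exact_mod_cast hle
  have hD1 : 0 ≤ 1 - 1 / (D : ℝ) := by
    rw [sub_nonneg, div_le_one (by linarith)]; exact hDr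
  rw [← ENNReal.coe_add, ← ENNReal.ofReal_coe_nnreal, ← ENNReal.ofReal_coe_nnreal (p := a + b),
    ← ENNReal.ofReal_mul hD1]
  apply ENNReal.ofReal_le_ofReal
  push_cast
  have : ((a : ℝ) + b) / D ≤ b := by rw [div_le_iff₀ (by linarith)]; linarith
  have e : (1 - 1 / (D : ℝ)) * (a + b) = a + b - ((a : ℝ) + b) / D := by ring
  rw [e]; linarith

theorem cubeQ_big {n : ℕ} (c c' : Fin n → ℝ) (r r' : ℝ) :
    ∃ c'' r'', 0 < r'' ∧ cubeQ c r ⊆ cubeQ c'' r'' ∧ cubeQ c' r' ⊆ cubeQ c'' r'' := by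
  set M := ‖c‖ + ‖c'‖ + |r| + |r'| + 1 with hM
  have hMp : 0 < M := by positivity
  refine ⟨fun _ => -M, 2 * M, by positivity, ?_, ?_⟩
  all_goals
    intro x hx
    rw [mem_cubeQ] at hx ⊢
    intro i
    have h1 := norm_le_pi_norm c i
    have h2 := norm_le_pi_norm c' i
    rw [Real.norm_eq_abs, abs_le] at h1 h2
    have := hx i
    have := le_abs_self r
    have := le_abs_self r'
    have := abs_nonneg r
    have := abs_nonneg r'
    have := norm_nonneg c
    have := norm_nonneg c'
    constructor <;> linarith

/-- Self-improvement on cubes with uniform constants. -/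
theorem cube_selfimprove (n : ℕ) (p : ℝ) (hp : 1 < p) (C : ℝ≥0∞) (hC : C ≠ ∞) :
    ∃ (q : ℝ) (C' : ℝ≥0∞), 1 < q ∧ q < p ∧ C' ≠ ∞ ∧
      ∀ w : (Fin n → ℝ) → ℝ≥0∞, Measurable w → (∀ x, w x ≠ ∞) →
      (∀ c r, 0 < r →
        (∫⁻ x in cubeQ c r, w x) * (∫⁻ x in cubeQ c r, w x ^ (-(1 / (p - 1)))) ^ (p - 1) ≤
          C * volume (cubeQ c r) ^ p) →
      ∀ c r, 0 < r →
        (∫⁻ x in cubeQ c r, w x) * (∫⁻ x in cubeQ c r, w x ^ (-(1 / (q - 1)))) ^ (q - 1) ≤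
          C' * volume (cubeQ c r) ^ q := by
  have hp0 : 0 < p := by linarith
  have hp1 : 0 < p - 1 := by linarith
  obtain ⟨D, hD, hCD⟩ : ∃ D : ℝ≥0, 1 ≤ D ∧ 2 ^ p * C ≤ (D : ℝ≥0∞) ^ (p - 1) := by
    have hX : (2 ^ p * C) ^ (1 / (p - 1)) ≠ ∞ :=
      ENNReal.rpow_ne_top_of_nonneg (by positivity)
        (ENNReal.mul_ne_top (ENNReal.rpow_ne_top_of_nonneg hp0.le (by simp)) hC)
    refine ⟨max 1 ((2 ^ p * C) ^ (1 / (p - 1))).toNNReal, le_max_left _ _, ?_⟩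
    calc 2 ^ p * C = ((2 ^ p * C) ^ (1 / (p - 1))) ^ (p - 1) := by
          rw [← ENNReal.rpow_mul, one_div, inv_mul_cancel₀ hp1.ne', ENNReal.rpow_one]
      _ = (((2 ^ p * C) ^ (1 / (p - 1))).toNNReal : ℝ≥0∞) ^ (p - 1) := by
          rw [ENNReal.coe_toNNReal hX]
      _ ≤ _ := by
          gcongr
          exact le_max_right _ _
  have hDr : (1 : ℝ) ≤ D := by exact_mod_cast hD
  have hD1 : 0 ≤ 1 - 1 / (D : ℝ) := by
    rw [sub_nonneg, div_le_one (by linarith)]; exact hDr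
  have hD2 : 1 - 1 / (D : ℝ) < 1 := by
    have : 0 < 1 / (D : ℝ) := by positivity
    linarith
  obtain ⟨ε, G, hε, hGt, hG⟩ := exists_eps_G n _ hD1 hD2
  have hε1 : 0 < 1 + ε := by linarith
  set q := 1 + (p - 1) / (1 + ε) with hq
  have hq1 : q - 1 = (p - 1) / (1 + ε) := by rw [hq]; ring
  have hq10 : 0 < q - 1 := by rw [hq1]; positivity
  refine ⟨q, G ^ (q - 1) * C, by linarith, ?_, ?_, ?_⟩
  · have : (p - 1) / (1 + ε) < p - 1 := by
      rw [div_lt_iff₀ hε1]; nlinarith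
    linarith
  · exact ENNReal.mul_ne_top (ENNReal.rpow_ne_top_of_nonneg hq10.le hGt) hC
  intro w hw hwt hA c r hr
  by_cases hz : ∀ c r, 0 < r → ∫⁻ x in cubeQ c r, w x = 0
  · rw [hz c r hr, zero_mul]; exact zero_le
  push Not at hz
  obtain ⟨c0, r0, hr0, hne⟩ := hz
  have hfin : ∀ c r, 0 < r → ∫⁻ x in cubeQ c r, w x ^ (-(1 / (p - 1))) ≠ ∞ := by
    intro c r hr
    obtain ⟨c2, r2, hr2, hs1, hs2⟩ := cubeQ_big c c0 r r0
    refine ne_top_of_le_ne_top ?_ (lintegral_mono_set hs1)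
    intro htop
    have h := hA c2 r2 hr2
    rw [htop, ENNReal.top_rpow_of_pos hp1, ENNReal.mul_top] at h
    · exact absurd h (not_le.2 (ENNReal.mul_lt_top hC.lt_top
        (ENNReal.rpow_ne_top_of_nonneg hp0.le (cubeQ_vol_ne_top c2 r2)).lt_top))
    · intro h0
      exact hne (le_antisymm (h0 ▸ lintegral_mono_set hs2) zero_le)
  have hRH := reverse_holder_cube (fun x => w x ^ (-(1 / (p - 1)))) (hw.pow_const _) ε hε hfin G _
    hG (fun c r hr U hU hUm hUv => cube_Ainfty w hw hwt p hp C D hD hCD c r hr (hA c r hr)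
      (hfin c r hr) U hU hUm hUv) c hr
  have hexp : ∀ x, (w x ^ (-(1 / (p - 1)))) ^ (1 + ε) = w x ^ (-(1 / (q - 1))) := fun x => by
    rw [← ENNReal.rpow_mul, hq1]; congr 1; field_simp
  simp only [hexp] at hRH
  have hAc := hA c r hr
  set V := volume (cubeQ c r) with hV
  have hV0 : V ≠ 0 := cubeQ_vol_ne_zero c hr
  have hVt : V ≠ ∞ := cubeQ_vol_ne_top c r
  set S := ∫⁻ x in cubeQ c r, w x ^ (-(1 / (p - 1))) with hS
  set W := ∫⁻ x in cubeQ c r, w x with hW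
  have hav : cubeAvg (fun x => w x ^ (-(1 / (p - 1)))) c r = S / V := rfl
  rw [hav] at hRH
  have e1 : (G * (S / V) ^ ε * S) ^ (q - 1) = G ^ (q - 1) * (S ^ (p - 1) * V ^ (q - p)) := by
    rw [ENNReal.mul_rpow_of_nonneg _ _ hq10.le, ENNReal.mul_rpow_of_nonneg _ _ hq10.le,
      ENNReal.div_rpow_of_nonneg _ _ hε.le, div_eq_mul_inv, ← ENNReal.rpow_neg,
      ENNReal.mul_rpow_of_nonneg _ _ hq10.le, ← ENNReal.rpow_mul, ← ENNReal.rpow_mul]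
    have e3 : S ^ (p - 1) = S ^ (ε * (q - 1)) * S ^ (q - 1) := by
      rw [← ENNReal.rpow_add_of_nonneg _ _ (by positivity) hq10.le, hq1]
      congr 1; field_simp; ring
    have e4 : -ε * (q - 1) = q - p := by
      rw [show q - p = (q - 1) - (p - 1) by ring, hq1]; field_simp; ring
    rw [e3, e4]; ring
  calc W * (∫⁻ x in cubeQ c r, w x ^ (-(1 / (q - 1)))) ^ (q - 1)
      ≤ W * (G * (S / V) ^ ε * S) ^ (q - 1) := by gcongr
    _ = G ^ (q - 1) * V ^ (q - p) * (W * S ^ (p - 1)) := by rw [e1]; ring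
    _ ≤ G ^ (q - 1) * V ^ (q - p) * (C * V ^ p) := by gcongr
    _ = G ^ (q - 1) * C * (V ^ (q - p) * V ^ p) := by ring
    _ = _ := by rw [← ENNReal.rpow_add _ _ hV0 hVt, sub_add_cancel]

theorem euc_ball_vol {n : ℕ} (z : Rn n) {ρ : ℝ} (hρ : 0 < ρ) :
    volume (ball z ρ) = ENNReal.ofReal ρ ^ n * volume (ball (0 : Rn n) 1) := by
  rw [Measure.addHaar_ball_of_pos _ _ hρ, finrank_euclideanSpace_fin, ENNReal.ofReal_pow hρ.le]

theorem cube_sub_ball {n : ℕ} (c : Fin n → ℝ) {r : ℝ} (hr : 0 < r) :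
    cubeQ c r ⊆ WithLp.toLp 2 ⁻¹' ball (WithLp.toLp 2 c : Rn n) (r * (n + 1)) := by
  intro x hx
  rw [mem_cubeQ] at hx
  rw [Set.mem_preimage, mem_ball, EuclideanSpace.dist_eq]
  rw [Real.sqrt_lt' (by positivity)]
  have h1 : ∑ i : Fin n, dist ((WithLp.toLp 2 x : Rn n) i) ((WithLp.toLp 2 c : Rn n) i) ^ 2 ≤
      ∑ i : Fin n, r ^ 2 := by
    refine Finset.sum_le_sum fun i _ => ?_
    have := hx i
    simp only [Real.dist_eq, sq_abs]
    apply sq_le_sq'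
    · linarith
    · linarith
  simp only [Finset.sum_const, Finset.card_univ, Fintype.card_fin, nsmul_eq_mul] at h1
  refine lt_of_le_of_lt h1 ?_
  have hn : (0 : ℝ) ≤ n := Nat.cast_nonneg n
  have : 0 < r ^ 2 := by positivity
  nlinarith [mul_nonneg hn this.le, mul_nonneg (mul_nonneg hn hn) this.le]

theorem ball_sub_cube {n : ℕ} (z : Rn n) {ρ : ℝ} (hρ : 0 < ρ) :
    WithLp.toLp 2 ⁻¹' ball z ρ ⊆ cubeQ (fun i => z i - ρ) (2 * ρ) := by
  intro x hx
  rw [Set.mem_preimage, mem_ball, dist_eq_norm] at hx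
  rw [mem_cubeQ]
  intro i
  have h := PiLp.norm_apply_le (WithLp.toLp 2 x - z) i
  have h2 := abs_lt.1 (lt_of_le_of_lt h hx)
  simp only [PiLp.sub_apply] at h2
  constructor <;> linarith [h2.1, h2.2]

/-- Self-improvement of the uniform Muckenhoupt condition (Lemma 2.2(ii)). -/
theorem statement15 {n : ℕ} (φ : Rn n → ℝ → ℝ)
    (hmeas : ∀ t : ℝ, Measurable fun x => φ x t)
    (huli : UnifLocInt φ) (p : ℝ) (hp : 1 < p)
    (hA : MemUniformA φ p) : ∃ q : ℝ, 1 < q ∧ q < p ∧ MemUniformA φ q := by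
  obtain ⟨h1, -⟩ | ⟨-, C, hC, hA⟩ := hA
  · exact absurd h1 hp.ne'
  have hp0 : 0 < p := by linarith
  have hp1 : 0 < p - 1 := by linarith
  set v := volume (ball (0 : Rn n) 1) with hv
  have hv0 : v ≠ 0 := (measure_ball_pos _ _ one_pos).ne'
  have hvt : v ≠ ∞ := measure_ball_lt_top.ne
  set K1 : ℝ≥0∞ := ENNReal.ofReal (n + 1) ^ n * v with hK1
  have hK1t : K1 ≠ ∞ := ENNReal.mul_ne_top (ENNReal.pow_ne_top ENNReal.ofReal_ne_top) hvt
  have hCt : C * K1 ^ p ≠ ∞ := ENNReal.mul_ne_top hC (ENNReal.rpow_ne_top_of_nonneg hp0.le hK1t)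
  obtain ⟨q, C', hq1, hqp, hC', H⟩ := cube_selfimprove n p hp (C * K1 ^ p) hCt
  have hq0 : 0 < q := by linarith
  have hq10 : 0 < q - 1 := by linarith
  set K2 : ℝ≥0∞ := 2 ^ n * v⁻¹ with hK2
  have hK2t : K2 ≠ ∞ := ENNReal.mul_ne_top (ENNReal.pow_ne_top (by simp)) (by simpa using hv0)
  refine ⟨q, hq1, hqp, Or.inr ⟨hq1, C' * K2 ^ q,
    ENNReal.mul_ne_top hC' (ENNReal.rpow_ne_top_of_nonneg hq0.le hK2t), ?_⟩⟩
  intro t ht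
  have hT : MeasurePreserving (WithLp.toLp 2 : (Fin n → ℝ) → Rn n) volume volume :=
    PiLp.volume_preserving_toLp (Fin n)
  have hφm : Measurable fun x : Rn n => ENNReal.ofReal (φ x t) := (hmeas t).ennreal_ofReal
  have hI : ∀ (z : Rn n) (ρ : ℝ) (f : Rn n → ℝ≥0∞), Measurable f →
      ∫⁻ x in ball z ρ, f x = ∫⁻ x in WithLp.toLp 2 ⁻¹' ball z ρ, f (WithLp.toLp 2 x) :=
    fun z ρ f hf => (hT.setLIntegral_comp_preimage measurableSet_ball hf).symm
  have Hc := H (fun x => ENNReal.ofReal (φ (WithLp.toLp 2 x) t)) (hφm.comp hT.measurable)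
    (fun x => ENNReal.ofReal_ne_top) ?_
  · intro z ρ hρ
    have h := Hc (fun i => z i - ρ) (2 * ρ) (by positivity)
    have hvol : volume (cubeQ (fun i => z i - ρ) (2 * ρ)) = K2 * volume (ball z ρ) := by
      rw [cubeQ_vol, euc_ball_vol z hρ, ← hv, hK2, ENNReal.ofReal_mul (by norm_num), mul_pow]
      rw [show (2 : ℝ≥0∞) ^ n * v⁻¹ * (ENNReal.ofReal ρ ^ n * v) =
        2 ^ n * ENNReal.ofReal ρ ^ n * (v⁻¹ * v) by ring, ENNReal.inv_mul_cancel hv0 hvt]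
      simp
    rw [hvol, ENNReal.mul_rpow_of_nonneg _ _ hq0.le, ← mul_assoc] at h
    refine le_trans ?_ h
    rw [hI z ρ _ hφm, hI z ρ _ (hφm.pow_const _)]
    gcongr <;> exact ball_sub_cube z hρ
  · intro c r hr
    have hR : 0 < r * (n + 1) := by positivity
    have h := hA t ht (WithLp.toLp 2 c) (r * (n + 1)) hR
    have hvol : volume (ball (WithLp.toLp 2 c : Rn n) (r * (n + 1))) =
        K1 * volume (cubeQ c r) := by
      rw [cubeQ_vol, euc_ball_vol _ hR, ← hv, hK1, ENNReal.ofReal_mul hr.le, mul_pow]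
      ring
    rw [hvol, ENNReal.mul_rpow_of_nonneg _ _ hp0.le, ← mul_assoc] at h
    refine le_trans ?_ h
    rw [hI _ _ _ hφm, hI _ _ _ (hφm.pow_const _)]
    gcongr <;> exact cube_sub_ball c hr
end
end
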